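/- arXiv:2007.11045 — 3 statements merged into one kernel-verified Lean document; each statement's English description precedes it below -/
import Mathlib

section
/- For all real q ≥ 2, the derivative of q ↦ log(√2 · (Γ((q+1)/2)/√π)^{1/q}) is at most 1/(2q). -/
open Real Finset

noncomputable def pNorm {n : ℕ} (p : ℝ) (v : Fin n → ℝ) : ℝ :=
  (∑ j, |v j| ^ p) ^ (1 / p)

noncomputable def signVec (m : ℕ) (s : Fin m → Bool) : Fin m → ℝ :=
  fun i => if s i then 1 else -1

noncomputable def expRademacher (m : ℕ) (f : (Fin m → ℝ) → ℝ) : ℝ :=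
  (∑ s : Fin m → Bool, f (signVec m s)) / 2 ^ m

lemma kh_hasDeriv_mul_log (c t : ℝ) (h : 0 < t + c) :
    HasDerivAt (fun t : ℝ => (t + c) * Real.log (t + c)) (Real.log (t + c) + 1) t := by
  have := (Real.hasDerivAt_mul_log h.ne').comp_add_const t c
  simpa using this

lemma kh_hasDeriv_log (c t : ℝ) (h : 0 < t + c) :
    HasDerivAt (fun t : ℝ => Real.log (t + c)) ((t + c)⁻¹) t := by
  have := (Real.hasDerivAt_log h.ne').comp_add_const t c
  simpa using this

lemma kh_cont (c : ℝ) : Continuous (fun t : ℝ => (t + c) * Real.log (t + c)) :=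
  Real.continuous_mul_log.comp (continuous_id.add continuous_const)

lemma kh_concave_end (c : ℝ) (hc : 0 ≤ c) :
    ConcaveOn ℝ (Set.Ici 0) (fun t : ℝ => -((t + c) * Real.log (t + c))) := by
  apply concaveOn_of_hasDerivWithinAt2_nonpos (convex_Ici 0)
    (f' := fun t => -(Real.log (t + c) + 1)) (f'' := fun t => -((t + c)⁻¹))
  · exact (kh_cont c).neg.continuousOn
  · intro x hx
    rw [interior_Ici] at hx
    have hx : 0 < x := hx
    exact (kh_hasDeriv_mul_log c x (by linarith)).neg.hasDerivWithinAt
  · intro x hx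
    rw [interior_Ici] at hx
    have hx : 0 < x := hx
    exact ((kh_hasDeriv_log c x (by linarith)).add_const 1).neg.hasDerivWithinAt
  · intro x hx
    rw [interior_Ici] at hx
    have hx : 0 < x := hx
    have : 0 < x + c := by linarith
    have := inv_pos.2 this
    linarith

lemma kh_concave_term (c : ℝ) (hc : 0 ≤ c) :
    ConcaveOn ℝ (Set.Ici 0) (fun t : ℝ => (t + (c + 1)) * Real.log (t + (c + 1))
      - (t + c) * Real.log (t + c) - Real.log (t + (c + 1 / 2))) := by
  apply concaveOn_of_hasDerivWithinAt2_nonpos (convex_Ici 0)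
    (f' := fun t => (Real.log (t + (c + 1)) + 1) - (Real.log (t + c) + 1) - (t + (c + 1 / 2))⁻¹)
    (f'' := fun t => (t + (c + 1))⁻¹ - (t + c)⁻¹ - (-1 / (t + (c + 1 / 2)) ^ 2))
  · refine ((kh_cont (c + 1)).sub (kh_cont c)).continuousOn.sub ?_
    refine ContinuousOn.log (by fun_prop) ?_
    intro x hx
    have hx : 0 ≤ x := hx
    positivity
  · intro x hx
    rw [interior_Ici] at hx
    have hx : 0 < x := hx
    exact (((kh_hasDeriv_mul_log _ x (by linarith)).sub (kh_hasDeriv_mul_log c x (by linarith))).sub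
      (kh_hasDeriv_log _ x (by linarith))).hasDerivWithinAt
  · intro x hx
    rw [interior_Ici] at hx
    have hx : 0 < x := hx
    refine ((((kh_hasDeriv_log _ x (by linarith)).add_const 1).sub
      ((kh_hasDeriv_log c x (by linarith)).add_const 1)).sub ?_).hasDerivWithinAt
    exact ((hasDerivAt_id x).add_const (c + 1 / 2)).inv (by simp; positivity)
  · intro x hx
    rw [interior_Ici] at hx
    have hx : 0 < x := hx
    have e : (x + (c + 1))⁻¹ - (x + c)⁻¹ - (-1 / (x + (c + 1 / 2)) ^ 2)
      = -(1 / 4) / ((x + c) * (x + (c + 1)) * (x + (c + 1 / 2)) ^ 2) := by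
      have h1 : x + (c + 1) ≠ 0 := by positivity
      have h2 : x + c ≠ 0 := by positivity
      have h3 : x + (c + 1 / 2) ≠ 0 := by positivity
      have r1 : x + (c + 1) = x + (c + 1 / 2) + 1 / 2 := by ring
      have r2 : x + c = x + (c + 1 / 2) - 1 / 2 := by ring
      generalize x + (c + 1) = u at *
      generalize x + (c + 1 / 2) = v at *
      generalize x + c = w at *
      field_simp
      rw [r1, r2]
      ring
    rw [e]
    apply div_nonpos_of_nonpos_of_nonneg (by norm_num)
    positivity

lemma kh_concave_sum (n : ℕ) :
    ConcaveOn ℝ (Set.Ici 0) (fun t : ℝ => (t + n) * Real.log (t + n) - t * Real.log t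
      - ∑ m ∈ Finset.range n, Real.log (1 / 2 + t + m)) := by
  induction n with
  | zero => simpa using concaveOn_const (0 : ℝ) (convex_Ici (0 : ℝ))
  | succ k ih =>
    refine (ih.add (kh_concave_term k k.cast_nonneg)).congr ?_
    intro t _
    simp only [Pi.add_apply, Finset.sum_range_succ]
    push_cast
    rw [show (1 / 2 + t + k : ℝ) = t + (k + 1 / 2) by ring]
    ring

lemma kh_concave_seq (n : ℕ) :
    ConcaveOn ℝ (Set.Ici 0)
      (fun t : ℝ => Real.BohrMollerup.logGammaSeq (1 / 2 + t) n - t * Real.log t) := by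
  have hlin : ConcaveOn ℝ (Set.Ici 0)
      (fun t : ℝ => (1 / 2 + t) * Real.log n + Real.log (n.factorial : ℝ)) := by
    refine ⟨convex_Ici 0, ?_⟩
    intro x _ y _ a b _ _ hab
    simp only [smul_eq_mul]
    have : b = 1 - a := by linarith
    subst this
    apply le_of_eq
    ring
  refine (((kh_concave_sum (n + 1)).add (kh_concave_end (n + 1) (by positivity))).add hlin).congr ?_
  intro t _
  simp only [Pi.add_apply, Real.BohrMollerup.logGammaSeq]
  push_cast
  ring

lemma kh_concave :
    ConcaveOn ℝ (Set.Ici 0)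
      (fun t : ℝ => Real.log (Real.Gamma (1 / 2 + t)) - t * Real.log t) := by
  have ht : ∀ t : ℝ, 0 ≤ t → Filter.Tendsto
      (fun n => Real.BohrMollerup.logGammaSeq (1 / 2 + t) n - t * Real.log t) Filter.atTop
      (nhds (Real.log (Real.Gamma (1 / 2 + t)) - t * Real.log t)) := fun t h =>
    (Real.BohrMollerup.tendsto_log_gamma (by positivity)).sub_const _
  refine ⟨convex_Ici 0, ?_⟩
  intro x hx y hy a b ha hb hab
  have hxy := (convex_Ici (0 : ℝ)) hx hy ha hb hab
  exact le_of_tendsto_of_tendsto' (((ht x hx).const_smul a).add ((ht y hy).const_smul b))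
    (ht _ hxy) (fun n => (kh_concave_seq n).2 hx hy ha hb hab)

/-- The derivative of q ↦ log c₂(q) is at most 1/(2q) for q ≥ 2. -/
theorem deriv_log_khintchine_const_le (q : ℝ) (hq : 2 ≤ q) :
    deriv (fun t : ℝ =>
        Real.log (Real.sqrt 2 * (Real.Gamma ((t + 1) / 2) / Real.sqrt π) ^ (1 / t))) q ≤
      1 / (2 * q) := by
  have hq0 : 0 < q := by linarith
  have hpi : 0 < Real.sqrt π := Real.sqrt_pos.2 Real.pi_pos
  obtain ⟨d, hd⟩ : ∃ d, HasDerivAt (fun x => Real.log (Real.Gamma x)) d (1 / 2 + q / 2) := by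
    have h : (0 : ℝ) < 1 / 2 + q / 2 := by positivity
    refine ⟨_, (DifferentiableAt.log (Real.differentiableAt_Gamma ?_)
      (Real.Gamma_pos_of_pos h).ne').hasDerivAt⟩
    intro m hm
    have : (0 : ℝ) ≤ m := m.cast_nonneg
    linarith
  -- tangent line inequality
  have key : d - (Real.log (q / 2) + 1) ≤
      slope (fun t : ℝ => Real.log (Real.Gamma (1 / 2 + t)) - t * Real.log t) 0 (q / 2) := by
    refine kh_concave.le_slope_of_hasDerivAt (by simp) (by simp; linarith) (by positivity) ?_
    exact (hd.comp_const_add (1 / 2) (q / 2)).sub (Real.hasDerivAt_mul_log (by positivity))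
  have hG : HasDerivAt (fun t : ℝ => Real.log (Real.Gamma ((t + 1) / 2))) (d * (1 / 2)) q := by
    have h1 : HasDerivAt (fun t : ℝ => (t + 1) / 2) (1 / 2) q :=
      ((hasDerivAt_id q).add_const 1).div_const 2
    have hd' : HasDerivAt (fun x => Real.log (Real.Gamma x)) d ((q + 1) / 2) := by
      rwa [show (q + 1) / 2 = 1 / 2 + q / 2 by ring]
    exact hd'.comp q h1
  have hF : HasDerivAt (fun t : ℝ => Real.log (Real.sqrt 2) +
      (Real.log (Real.Gamma ((t + 1) / 2)) - Real.log (Real.sqrt π)) / t)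
      ((d * (1 / 2) * q - (Real.log (Real.Gamma ((q + 1) / 2)) - Real.log (Real.sqrt π)) * 1)
        / q ^ 2) q :=
    ((hG.sub_const _).div (hasDerivAt_id q) hq0.ne').const_add _
  have hev : (fun t : ℝ =>
      Real.log (Real.sqrt 2 * (Real.Gamma ((t + 1) / 2) / Real.sqrt π) ^ (1 / t))) =ᶠ[nhds q]
      (fun t : ℝ => Real.log (Real.sqrt 2) +
      (Real.log (Real.Gamma ((t + 1) / 2)) - Real.log (Real.sqrt π)) / t) := by
    filter_upwards [lt_mem_nhds hq0] with t ht
    have hg : 0 < Real.Gamma ((t + 1) / 2) := Real.Gamma_pos_of_pos (by positivity)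
    rw [Real.log_mul (by positivity) (by positivity), Real.log_rpow (by positivity),
      Real.log_div hg.ne' hpi.ne']
    ring
  rw [hev.deriv_eq, hF.deriv]
  rw [slope_def_field, le_div_iff₀ (by linarith)] at key
  simp only [sub_zero, add_zero, zero_mul, Real.Gamma_one_half_eq] at key
  rw [show (1 : ℝ) / 2 + q / 2 = (q + 1) / 2 by ring] at key
  rw [div_le_div_iff₀ (by positivity) (by positivity)]
  nlinarith [mul_nonneg hq0.le (sub_nonneg.2 key)]
end

section
/- Let x₁,…,x_m ∈ ℝ^d, σᵢ i.i.d. Rademacher variables, 1 < p ≤ 2 with conjugate p* ≥ 2, and W > 0. Then E_σ[ sup_{‖w‖_p ≤ W} (1/m) Σᵢ σᵢ (w·xᵢ) ] ≤ (√2·W/m) · (Γ((p*+1)/2)/√π)^{1/p*} · ‖Xᵀ‖_{2,p*}. -/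
open Real Finset

section
open MeasureTheory ProbabilityTheory in
lemma gauss_abs_rpow_integrable (q : ℝ) (hq : 1 ≤ q) (y : ℝ) (v : NNReal) :
    Integrable (fun z : ℝ => |y + z| ^ q) (gaussianReal 0 v) := by
  have h : MemLp (fun z : ℝ => y + z) (ENNReal.ofReal q) (gaussianReal 0 v) := by
    have h1 := memLp_id_gaussianReal' (μ := 0) (v := v) (ENNReal.ofReal q) ENNReal.ofReal_ne_top
    exact (memLp_const y).add h1
  have := h.integrable_norm_rpow (by simp; linarith) ENNReal.ofReal_ne_top
  simpa [ENNReal.toReal_ofReal (by linarith : (0:ℝ) ≤ q)] using this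

noncomputable def gm (q : ℝ) : ℝ := 2 ^ (q / 2) * Real.Gamma ((q + 1) / 2) / Real.sqrt π

open MeasureTheory ProbabilityTheory in
lemma gauss_moment (q : ℝ) (hq : 0 ≤ q) :
    ∫ z, |z| ^ q ∂(gaussianReal 0 1) = gm q := by
  rw [integral_gaussianReal_eq_integral_smul one_ne_zero]
  simp only [gaussianPDFReal, smul_eq_mul, sub_zero, NNReal.coe_one, mul_one]
  have : ∀ z : ℝ, (√(2 * π))⁻¹ * rexp (-z ^ 2 / 2) * |z| ^ q =
      (fun t : ℝ => (√(2 * π))⁻¹ * (t ^ q * rexp (-(1/2) * t ^ (2:ℝ)))) |z| := by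
    intro z
    simp only [rpow_two, sq_abs]
    rw [show -z ^ 2 / 2 = -(1/2) * z^2 by ring]; ring
  simp_rw [this]
  rw [integral_comp_abs (f := fun t : ℝ => (√(2 * π))⁻¹ * (t ^ q * rexp (-(1/2) * t ^ (2:ℝ)))),
    integral_const_mul, integral_rpow_mul_exp_neg_mul_rpow (by norm_num) (by linarith) (by norm_num)]
  unfold gm
  rw [show (1/2 : ℝ) = 2⁻¹ by norm_num, inv_rpow (by norm_num), ← rpow_neg (by norm_num), neg_div, neg_neg,
    sqrt_mul (by norm_num), show (q+1)/2 = q/2 + 1/2 by ring, rpow_add (by norm_num), ← sqrt_eq_rpow]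
  have := sqrt_pos.2 pi_pos
  have h2 : 0 < √(2:ℝ) := by positivity
  field_simp

open MeasureTheory ProbabilityTheory in
lemma gauss_moment_scale (q : ℝ) (hq : 0 ≤ q) (c : ℝ) :
    ∫ z, |z| ^ q ∂(gaussianReal 0 (Real.toNNReal (c^2))) = |c| ^ q * gm q := by
  have h := gaussianReal_map_const_mul (μ := 0) (v := 1) c
  rw [mul_zero, mul_one] at h
  have h2 : (NNReal.mk (c ^ 2) (sq_nonneg c)) = Real.toNNReal (c^2) := by
    ext; simp [sq_nonneg]
  rw [← h2, ← h, integral_map (by fun_prop) (by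
    apply Measurable.aestronglyMeasurable; fun_prop)]
  simp_rw [abs_mul, mul_rpow (abs_nonneg _) (abs_nonneg _)]
  rw [integral_const_mul, gauss_moment q hq]

lemma hasDerivAt_mul_abs_rpow (q : ℝ) (hq : 3 < q) (x : ℝ) :
    HasDerivAt (fun x : ℝ => |x| ^ (q - 2) * x) ((q - 1) * |x| ^ (q-2)) x := by
  have h := (hasDerivAt_abs_rpow x (p := q - 2) (by linarith)).mul (hasDerivAt_id x)
  have h' : HasDerivAt (fun x : ℝ => |x| ^ (q - 2) * x) _ x := h
  refine h'.congr_deriv ?_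
  rcases eq_or_ne x 0 with rfl | hx
  · have h0 : (0:ℝ) ^ (q - 2) = 0 := zero_rpow (by linarith)
    simp [h0]
  · have : |x| ^ (q - 2) = |x| ^ (q-2-2) * x^2 := by
      rw [← sq_abs x, ← rpow_natCast |x| 2, ← rpow_add (abs_pos.2 hx)]; norm_num
    simp only [id, mul_one]
    rw [mul_assoc, mul_assoc, ← sq, ← this]; ring

lemma convexOn_abs_rpow (r : ℝ) (hr : 1 ≤ r) : ConvexOn ℝ Set.univ (fun x : ℝ => |x| ^ r) := by
  refine ⟨convex_univ, fun x _ y _ a b ha hb hab => ?_⟩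
  have h := (convexOn_rpow hr).2 (abs_nonneg x) (abs_nonneg y) ha hb hab
  refine le_trans ?_ h
  apply rpow_le_rpow (abs_nonneg _) _ (by linarith)
  simp only [smul_eq_mul]
  refine (abs_add_le _ _).trans ?_
  rw [abs_mul, abs_mul, abs_of_nonneg ha, abs_of_nonneg hb]

lemma abs_rpow_sum_mono (r : ℝ) (hr : 1 ≤ r) (y t1 t2 : ℝ) (h1 : 0 ≤ t1) (h2 : t1 ≤ t2) :
    |t1 + y| ^ r + |t1 - y| ^ r ≤ |t2 + y| ^ r + |t2 - y| ^ r := by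
  have hc := convexOn_abs_rpow r hr
  rcases eq_or_lt_of_le (h1.trans h2) with h | h
  · have : t1 = 0 := by linarith
    rw [this, ← h]
  have e1 : |t2 - y| = |y - t2| := abs_sub_comm _ _
  have e2 : |t1 - y| = |y - t1| := abs_sub_comm _ _
  have hd : t1 / t2 ≤ 1 := by rw [div_le_one h]; exact h2
  have hd0 : 0 ≤ t1 / t2 := by positivity
  have A := hc.2 (Set.mem_univ (t2 + y)) (Set.mem_univ (y - t2)) 
    (by linarith : (0:ℝ) ≤ (1 + t1/t2)/2) (by linarith : (0:ℝ) ≤ (1 - t1/t2)/2) (by ring)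
  have B := hc.2 (Set.mem_univ (t2 + y)) (Set.mem_univ (y - t2)) 
    (by linarith : (0:ℝ) ≤ (1 - t1/t2)/2) (by linarith : (0:ℝ) ≤ (1 + t1/t2)/2) (by ring)
  simp only [smul_eq_mul] at A B
  rw [show (1 + t1 / t2) / 2 * (t2 + y) + (1 - t1 / t2) / 2 * (y - t2) = t1 + y by field_simp; ring] at A
  rw [show (1 - t1 / t2) / 2 * (t2 + y) + (1 + t1 / t2) / 2 * (y - t2) = y - t1 by field_simp; ring] at B
  rw [e1, e2]
  linarith

/-- quadratic minorant of the symmetrised power -/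
lemma quad_minorant (q : ℝ) (hq : 3 < q) (y a : ℝ) (ha : 0 < a) :
    ∃ l : ℝ, ∀ z : ℝ, |a + y| ^ q + |a - y| ^ q + l * (z ^ 2 - a ^ 2) ≤ |z + y| ^ q + |z - y| ^ q := by
  set s : ℝ → ℝ := fun x => |x| ^ (q - 2) * x with hs
  have hs1 : ∀ x, HasDerivAt s ((q - 1) * |x| ^ (q-2)) x := hasDerivAt_mul_abs_rpow q hq
  have hp1 : ∀ x : ℝ, HasDerivAt (fun x : ℝ => |x| ^ q) (q * s x) x := by
    intro x
    refine (hasDerivAt_abs_rpow x (p := q) (by linarith)).congr_deriv ?_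
    simp only [hs]; ring
  set u : ℝ → ℝ := fun t => s (t + y) + s (t - y) with hu
  have hu1 : ∀ t, HasDerivAt u ((q - 1) * (|t + y| ^ (q-2) + |t - y| ^ (q-2))) t := by
    intro t
    have h1 := (hs1 (t + y)).comp_add_const t y
    have h2 := (hs1 (t - y)).comp_sub_const t y
    refine (h1.add h2).congr_deriv (by ring)
  have hu0 : u 0 = 0 := by simp [hu, hs]
  have hconv : ConvexOn ℝ (Set.Ici 0) u := by
    refine MonotoneOn.convexOn_of_deriv (convex_Ici 0)
      (fun t _ => (hu1 t).continuousAt.continuousWithinAt)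
      (fun t _ => (hu1 t).differentiableAt.differentiableWithinAt) ?_
    intro t1 ht1 t2 ht2 h12
    rw [(hu1 t1).deriv, (hu1 t2).deriv]
    rw [interior_Ici] at ht1
    exact mul_le_mul_of_nonneg_left (abs_rpow_sum_mono _ (by linarith) y t1 t2 (le_of_lt ht1) h12) (by linarith)
  -- u t ≤ (t/a) u a for t ≤ a, reverse for t ≥ a
  have hlo : ∀ t, 0 ≤ t → t ≤ a → u t ≤ t / a * u a := by
    intro t ht hta
    have := hconv.2 (Set.mem_Ici.2 le_rfl) (Set.mem_Ici.2 ha.le) 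
      (by rw [sub_nonneg, div_le_one ha]; exact hta : (0:ℝ) ≤ 1 - t / a) (by positivity : (0:ℝ) ≤ t / a) (by ring)
    simp only [smul_eq_mul, mul_zero, zero_add, hu0] at this
    rwa [div_mul_cancel₀ _ ha.ne'] at this
  have hhi : ∀ t, a ≤ t → t / a * u a ≤ u t := by
    intro t hta
    have ht : 0 < t := by linarith
    have := hconv.2 (Set.mem_Ici.2 le_rfl) (Set.mem_Ici.2 ht.le) 
      (by rw [sub_nonneg, div_le_one ht]; exact hta : (0:ℝ) ≤ 1 - a / t) (by positivity : (0:ℝ) ≤ a / t) (by ring)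
    simp only [smul_eq_mul, mul_zero, zero_add, hu0] at this
    rw [div_mul_cancel₀ _ ht.ne'] at this
    calc t / a * u a ≤ t / a * (a / t * u t) := by gcongr
      _ = u t := by field_simp
  refine ⟨q * u a / (2 * a), ?_⟩
  set l := q * u a / (2 * a) with hl
  set F : ℝ → ℝ := fun t => |t + y| ^ q + |t - y| ^ q - l * t ^ 2 with hF
  have hF1 : ∀ t, HasDerivAt F (q * (u t - t / a * u a)) t := by
    intro t
    have h1 := (hp1 (t + y)).comp_add_const t y
    have h2 := (hp1 (t - y)).comp_sub_const t y
    have h3 := ((hasDerivAt_pow 2 t).const_mul l)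
    refine ((h1.add h2).sub h3).congr_deriv ?_
    simp only [hu, hl]; field_simp; ring
  have hFc : Continuous F := continuous_iff_continuousAt.2 fun t => (hF1 t).continuousAt
  have hmin : ∀ t, 0 ≤ t → F a ≤ F t := by
    intro t ht
    rcases le_total t a with h | h
    · have : AntitoneOn F (Set.Icc 0 a) := by
        refine antitoneOn_of_deriv_nonpos (convex_Icc 0 a) hFc.continuousOn
          (fun t _ => (hF1 t).differentiableAt.differentiableWithinAt) ?_
        intro x hx
        rw [interior_Icc] at hx
        rw [(hF1 x).deriv]
        have := hlo x hx.1.le hx.2.le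
        exact mul_nonpos_of_nonneg_of_nonpos (by linarith) (by linarith)
      exact this ⟨ht, h⟩ ⟨ha.le, le_rfl⟩ h
    · have : MonotoneOn F (Set.Ici a) := by
        refine monotoneOn_of_deriv_nonneg (convex_Ici a) hFc.continuousOn
          (fun t _ => (hF1 t).differentiableAt.differentiableWithinAt) ?_
        intro x hx
        rw [interior_Ici] at hx
        rw [(hF1 x).deriv]
        have := hhi x (le_of_lt hx)
        exact mul_nonneg (by linarith) (by linarith)
      exact this (Set.mem_Ici.2 le_rfl) h h
  have heven : ∀ t, F (-t) = F t := by
    intro t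
    simp only [hF]
    rw [show -t + y = -(t - y) by ring, show -t - y = -(t+y) by ring, abs_neg, abs_neg]; ring
  intro z
  have : F a ≤ F z := by
    rcases le_total 0 z with h | h
    · exact hmin z h
    · rw [← heven z]; exact hmin _ (by linarith)
  simp only [hF] at this
  linarith

open MeasureTheory ProbabilityTheory in
lemma step_gauss (q : ℝ) (hq : 3 < q) (y a : ℝ) :
    (|y + a| ^ q + |y - a| ^ q) / 2 ≤ ∫ z, |y + z| ^ q ∂(gaussianReal 0 (Real.toNNReal (a^2))) := by
  wlog ha : 0 < a generalizing a
  · rcases eq_or_lt_of_le (not_lt.1 ha) with h | h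
    · subst h; simp
    · have := this (-a) (by linarith)
      rw [neg_sq] at this
      refine le_trans (le_of_eq ?_) this
      rw [← sub_eq_add_neg, sub_neg_eq_add, add_comm]
  obtain ⟨l, hl⟩ := quad_minorant q hq y a ha
  set μ := gaussianReal 0 (Real.toNNReal (a^2)) with hμ
  have i1 : Integrable (fun z : ℝ => |y + z| ^ q) μ := gauss_abs_rpow_integrable q (by linarith) y _
  have hneg : μ.map (fun x => -x) = μ := by
    rw [hμ, gaussianReal_map_neg]; simp
  have e1 : ∫ z, |y - z| ^ q ∂μ = ∫ z, |y + z| ^ q ∂μ := by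
    conv_rhs => rw [← hneg]
    rw [integral_map (by fun_prop) (by apply Measurable.aestronglyMeasurable; fun_prop)]
    simp [sub_eq_add_neg]
  have i2 : Integrable (fun z : ℝ => |y - z| ^ q) μ := by
    have := i1
    rw [← hneg, integrable_map_measure (by apply Measurable.aestronglyMeasurable; fun_prop) (by fun_prop)] at this
    simpa [Function.comp_def, sub_eq_add_neg] using this
  have m2 : ∫ z, z ^ 2 ∂μ = a ^ 2 := by
    have := gauss_moment_scale 2 (by norm_num) a
    have g2 : gm 2 = 1 := by
      unfold gm
      rw [show ((2:ℝ)+1)/2 = 1/2 + 1 by norm_num, Gamma_add_one (by norm_num), Gamma_one_half_eq]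
      have := sqrt_pos.2 pi_pos
      norm_num
      field_simp
    rw [g2] at this
    simpa using this
  have i3 : Integrable (fun z : ℝ => z ^ 2) μ := by
    have := gauss_abs_rpow_integrable 2 (by norm_num) 0 (Real.toNNReal (a^2))
    simpa using this
  have key : ∫ z, ((|a + y| ^ q + |a - y| ^ q - l * a ^ 2) + l * z ^ 2) ∂μ ≤ ∫ z, (|y + z| ^ q + |y - z| ^ q) ∂μ := by
    apply integral_mono
    · exact (integrable_const _).add (i3.const_mul l)
    · exact i1.add i2
    · intro z
      have := hl z
      rw [add_comm z y, abs_sub_comm z y] at this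
      show _ ≤ |y + z| ^ q + |y - z| ^ q
      linarith
  rw [integral_add (integrable_const _) (i3.const_mul l), integral_const_mul, integral_add i1 i2, e1, m2] at key
  simp only [integral_const, probReal_univ, one_smul] at key
  rw [add_comm a y, abs_sub_comm a y] at key
  linarith

end

section

noncomputable def ES (m : ℕ) (a : Fin m → ℝ) (f : ℝ → ℝ) : ℝ :=
  (∑ s : Fin m → Bool, f (∑ i, signVec m s i * a i)) / 2 ^ m

lemma ES_succ (m : ℕ) (p : Fin (m+1)) (a : Fin (m+1) → ℝ) (f : ℝ → ℝ) :
    ES (m+1) a f = ES m (fun i => a (p.succAbove i)) (fun t => (f (t + a p) + f (t - a p)) / 2) := by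
  unfold ES
  rw [← (Fin.insertNthEquiv (fun _ => Bool) p).sum_comp, Fintype.sum_prod_type]
  simp only [Fintype.sum_bool, Fin.sum_univ_succAbove _ p, signVec, Fin.insertNthEquiv_apply,
    Fin.insertNth_apply_same, Fin.insertNth_apply_succAbove]
  simp only [← Finset.sum_div, Finset.sum_add_distrib]
  rw [pow_succ]
  simp only [if_true, one_mul, Bool.false_eq_true, if_false, neg_mul, add_comm, sub_eq_add_neg]
  field_simp

lemma ES_mono (m : ℕ) (a : Fin m → ℝ) (f g : ℝ → ℝ) (h : ∀ t, f t ≤ g t) : ES m a f ≤ ES m a g := by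
  unfold ES
  gcongr
  exact h _

lemma ES_add (m : ℕ) (a : Fin m → ℝ) (f g : ℝ → ℝ) : ES m a (fun t => f t + g t) = ES m a f + ES m a g := by
  unfold ES
  rw [Finset.sum_add_distrib, add_div]

lemma ES_mul (m : ℕ) (a : Fin m → ℝ) (c : ℝ) (f : ℝ → ℝ) : ES m a (fun t => c * f t) = c * ES m a f := by
  unfold ES
  rw [← Finset.mul_sum, mul_div_assoc]

lemma ES_const (m : ℕ) (a : Fin m → ℝ) (c : ℝ) : ES m a (fun _ => c) = c := by
  unfold ES
  simp

lemma ES_sq (m : ℕ) : ∀ (a : Fin m → ℝ) (x : ℝ), ES m a (fun t => (x + t) ^ 2) = x ^ 2 + ∑ i, a i ^ 2 := by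
  induction m with
  | zero => intro a x; simp [ES]
  | succ m ih =>
    intro a x
    rw [ES_succ m 0, Fin.sum_univ_succAbove _ 0]
    have : (fun t : ℝ => ((x + (t + a 0)) ^ 2 + (x + (t - a 0)) ^ 2) / 2) = fun t => (x + t)^2 + a 0 ^ 2 := by
      funext t; ring
    rw [this, ES_add, ES_const, ih]; ring

lemma ES_cos (m : ℕ) : ∀ (a : Fin m → ℝ) (x τ : ℝ), ES m a (fun t => cos (τ * (x + t))) = cos (τ * x) * ∏ i, cos (τ * a i) := by
  induction m with
  | zero => intro a x τ; simp [ES]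
  | succ m ih =>
    intro a x τ
    rw [ES_succ m 0, Fin.prod_univ_succAbove _ 0]
    have : (fun t : ℝ => (cos (τ * (x + (t + a 0))) + cos (τ * (x + (t - a 0)))) / 2)
        = fun t => cos (τ * a 0) * cos (τ * (x + t)) := by
      funext t
      rw [show τ * (x + (t + a 0)) = τ * (x + t) + τ * a 0 by ring,
        show τ * (x + (t - a 0)) = τ * (x + t) - τ * a 0 by ring, cos_add, cos_sub]; ring
    rw [this, ES_mul, ih]; ring

open MeasureTheory ProbabilityTheory in
lemma gauss_conv_abs (q : ℝ) (hq : 1 ≤ q) (x : ℝ) (v w : NNReal) :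
    Integrable (fun z => ∫ u, |x + z + u| ^ q ∂(gaussianReal 0 w)) (gaussianReal 0 v) ∧
    ∫ z, ∫ u, |x + z + u| ^ q ∂(gaussianReal 0 w) ∂(gaussianReal 0 v) =
      ∫ z, |x + z| ^ q ∂(gaussianReal 0 (v + w)) := by
  have hc : gaussianReal 0 (v + w) = ((gaussianReal 0 v).prod (gaussianReal 0 w)).map (fun p : ℝ × ℝ => p.1 + p.2) := by
    have := gaussianReal_conv_gaussianReal (m₁ := 0) (m₂ := 0) (v₁ := v) (v₂ := w)
    rw [add_zero] at this
    rw [← this]; rfl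
  have hi := gauss_abs_rpow_integrable q hq x (v + w)
  rw [hc, integrable_map_measure (by apply Measurable.aestronglyMeasurable; fun_prop) (by fun_prop)] at hi
  have hi' : Integrable (fun p : ℝ × ℝ => |x + p.1 + p.2| ^ q) ((gaussianReal 0 v).prod (gaussianReal 0 w)) := by
    simpa [Function.comp_def, add_assoc] using hi
  refine ⟨hi'.integral_prod_left, ?_⟩
  rw [hc, integral_map (by fun_prop) (by apply Measurable.aestronglyMeasurable; fun_prop), ← integral_prod _ hi']
  simp [add_assoc]

open MeasureTheory ProbabilityTheory in
lemma ES_integral (m : ℕ) (a : Fin m → ℝ) (μ : Measure ℝ) (f : ℝ → ℝ → ℝ)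
    (h : ∀ t, Integrable (f t) μ) : Integrable (fun z => ES m a (fun t => f t z)) μ ∧
      ES m a (fun t => ∫ z, f t z ∂μ) = ∫ z, ES m a (fun t => f t z) ∂μ := by
  unfold ES
  refine ⟨(integrable_finsetSum _ fun i _ => h _).div_const _, ?_⟩
  rw [integral_div, integral_finsetSum _ fun i _ => h _]

open MeasureTheory ProbabilityTheory in
lemma gauss_dom (q : ℝ) (hq : 3 < q) (m : ℕ) : ∀ (a : Fin m → ℝ) (x : ℝ),
    ES m a (fun t => |x + t| ^ q) ≤ ∫ z, |x + z| ^ q ∂(gaussianReal 0 (Real.toNNReal (∑ i, a i ^ 2))) := by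
  induction m with
  | zero => intro a x; simp [ES]
  | succ m ih =>
    intro a x
    rw [ES_succ m 0, Fin.sum_univ_succAbove _ 0, Real.toNNReal_add (sq_nonneg _) (Finset.sum_nonneg fun i _ => sq_nonneg _)]
    obtain ⟨hI, hE⟩ := gauss_conv_abs q (by linarith) x (Real.toNNReal (a 0 ^ 2))
      (Real.toNNReal (∑ i, a ((0 : Fin (m+1)).succAbove i) ^ 2))
    obtain ⟨hI2, hE2⟩ := ES_integral m (fun i => a ((0 : Fin (m+1)).succAbove i)) (gaussianReal 0 (Real.toNNReal (a 0 ^ 2)))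
      (fun t z => |(x + t) + z| ^ q) (fun t => gauss_abs_rpow_integrable q (by linarith) (x + t) _)
    rw [← hE]
    refine (ES_mono _ _ _ _ fun t => ?_).trans (hE2.trans_le (integral_mono hI2 hI fun z => ?_))
    · rw [← add_assoc, ← add_sub_assoc]
      exact step_gauss q hq (x + t) (a 0)
    · have := ih (fun i => a ((0 : Fin (m+1)).succAbove i)) (x + z)
      refine le_trans (le_of_eq ?_) this
      congr 1; funext t; congr 2; ring

open MeasureTheory ProbabilityTheory in
lemma khin_A (q : ℝ) (hq : 3 < q) (m : ℕ) (a : Fin m → ℝ) :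
    ES m a (fun t => |t| ^ q) ≤ gm q * (∑ i, a i ^ 2) ^ (q / 2) := by
  have h := gauss_dom q hq m a 0
  simp only [zero_add] at h
  have hs : 0 ≤ ∑ i, a i ^ 2 := Finset.sum_nonneg fun i _ => sq_nonneg _
  have h2 := gauss_moment_scale q (by linarith) (√(∑ i, a i ^ 2))
  rw [sq_sqrt hs] at h2
  rw [h2, abs_of_nonneg (sqrt_nonneg _), sqrt_eq_rpow, ← rpow_mul hs, mul_comm] at h
  rwa [show 1 / 2 * q = q / 2 by ring] at h

end

section

lemma Gamma_ratio_lower (y δ : ℝ) (hy : 1 < y) (h0 : 0 < δ) (h1 : δ < 1) :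
    (y - 1) ^ δ * Real.Gamma y ≤ Real.Gamma (y + δ) := by
  have h := Real.Gamma_mul_add_mul_le_rpow_Gamma_mul_rpow_Gamma (s := y - 1 + δ) (t := y + δ) (a := δ) (b := 1 - δ)
    (by linarith) (by linarith) h0 (by linarith) (by ring)
  rw [show δ * (y - 1 + δ) + (1 - δ) * (y + δ) = y by ring] at h
  have hp : 0 < y - 1 + δ := by linarith
  have hG := Real.Gamma_pos_of_pos hp
  have e : Real.Gamma (y + δ) = (y - 1 + δ) * Real.Gamma (y - 1 + δ) := by
    rw [← Real.Gamma_add_one hp.ne']; congr 1; ring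
  have hle : (y - 1) ^ δ ≤ (y - 1 + δ) ^ δ := rpow_le_rpow (by linarith) (by linarith) h0.le
  have hGy := Real.Gamma_pos_of_pos (by linarith : 0 < y)
  calc (y - 1) ^ δ * Real.Gamma y ≤ (y - 1 + δ) ^ δ * (Real.Gamma (y - 1 + δ) ^ δ * Real.Gamma (y + δ) ^ (1 - δ)) := by
        gcongr
    _ = Real.Gamma (y + δ) ^ δ * Real.Gamma (y + δ) ^ (1 - δ) := by
        rw [← mul_assoc, ← mul_rpow hp.le hG.le, ← e]
    _ = Real.Gamma (y + δ) := by
        rw [← rpow_add (Real.Gamma_pos_of_pos (by linarith))]; simp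

lemma Gamma_ratio_chain (δ : ℝ) (h0 : 0 < δ) (n : ℕ) :
    Real.Gamma (3/2 + n + δ) / Real.Gamma (3/2 + n) ≤
      Real.Gamma (3/2 + δ) / Real.Gamma (3/2) * exp (δ * ∑ k ∈ Finset.range n, 1 / ((k:ℝ) + 3/2)) := by
  induction n with
  | zero => simp
  | succ n ih =>
    have hg1 := Real.Gamma_pos_of_pos (by positivity : 0 < 3/2 + (n:ℝ))
    have hg2 := Real.Gamma_pos_of_pos (by positivity : 0 < 3/2 + (n:ℝ) + δ)
    rw [Finset.sum_range_succ, mul_add, exp_add, ← mul_assoc]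
    have e : Real.Gamma (3/2 + (n+1:ℕ) + δ) / Real.Gamma (3/2 + (n+1:ℕ)) =
        Real.Gamma (3/2 + n + δ) / Real.Gamma (3/2 + n) * (1 + δ / (n + 3/2)) := by
      push_cast
      rw [show 3/2 + ((n:ℝ)+1) + δ = (3/2 + n + δ) + 1 by ring, show 3/2 + ((n:ℝ)+1) = (3/2 + n) + 1 by ring,
        Real.Gamma_add_one (by positivity), Real.Gamma_add_one (by positivity)]
      field_simp
      ring
    rw [e]
    have h2 : 1 + δ / (n + 3/2) ≤ exp (δ * (1 / (n + 3/2))) := by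
      have := add_one_le_exp (δ * (1 / ((n:ℝ) + 3/2)))
      rw [mul_one_div] at this ⊢
      linarith
    gcongr

lemma gm_eq (δ : ℝ) : gm (2 + 2 * δ) = 2 ^ δ * (Real.Gamma (3/2 + δ) / Real.Gamma (3/2)) := by
  unfold gm
  rw [show (3/2 : ℝ) = 1/2 + 1 by norm_num, Gamma_add_one (by norm_num), Gamma_one_half_eq,
    show (2 + 2 * δ) / 2 = δ + 1 by ring, rpow_add (by norm_num), rpow_one,
    show (2 + 2 * δ + 1) / 2 = 1/2 + 1 + δ by ring]
  have := sqrt_pos.2 pi_pos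
  field_simp

lemma gm_lower (δ : ℝ) (h0 : 0 < δ) (h1 : δ < 1) : (1.427:ℝ) ^ (2 * δ) ≤ gm (2 + 2 * δ) := by
  have hc := Gamma_ratio_chain δ h0 40
  have hl := Gamma_ratio_lower (3/2 + 40) δ (by norm_num) h0 h1
  push_cast at hc
  set Sg := ∑ k ∈ Finset.range 40, 1 / ((k:ℝ) + 3/2) with hSg
  have hg := Real.Gamma_pos_of_pos (by norm_num : (0:ℝ) < 3/2 + 40)
  rw [← le_div_iff₀ hg] at hl
  have h3 := hl.trans hc
  rw [gm_eq]
  have hexp := exp_pos (δ * Sg)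
  have h4 : (3/2 + 40 - 1 : ℝ) ^ δ * exp (-(δ * Sg)) ≤ Real.Gamma (3/2 + δ) / Real.Gamma (3/2) := by
    rw [exp_neg, ← div_eq_mul_inv, div_le_iff₀ hexp]; exact h3
  have h5 : Sg ≤ 4 * 1.0986122 - 2 * 0.357 := by
    rw [hSg]
    simp only [Finset.sum_range_succ, Finset.sum_range_zero]
    norm_num
  have h6 : (1.427:ℝ) ≤ exp 0.357 := by
    have := Real.sum_le_exp_of_nonneg (x := 0.357) (by norm_num) 5
    refine le_trans ?_ this
    simp only [Finset.sum_range_succ, Finset.sum_range_zero, Nat.factorial]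
    norm_num
  have h81 : (2:ℝ) ^ δ * (3/2 + 40 - 1 : ℝ) ^ δ = exp (δ * (4 * log 3)) := by
    rw [← mul_rpow (by norm_num) (by norm_num), show (2:ℝ) * (3/2 + 40 - 1) = 3 ^ 4 by norm_num,
      rpow_def_of_pos (by norm_num), log_pow]
    push_cast; ring_nf
  calc (1.427:ℝ) ^ (2 * δ) ≤ (exp 0.357) ^ (2 * δ) := rpow_le_rpow (by norm_num) h6 (by linarith)
    _ = exp (0.357 * (2 * δ)) := by rw [← exp_mul]
    _ ≤ exp (δ * (4 * log 3) + -(δ * Sg)) := by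
        apply exp_le_exp.2
        have := Real.log_three_gt_d9
        nlinarith
    _ = 2 ^ δ * ((3/2 + 40 - 1 : ℝ) ^ δ * exp (-(δ * Sg))) := by
        rw [exp_add, ← h81]; ring
    _ ≤ _ := by gcongr

lemma cube_sym (a y : ℝ) (ha : 0 < a) :
    (|y + a| ^ 3 + |y - a| ^ 3) / 2 ≤ a ^ 3 + 3 * a * y ^ 2 + |y| ^ (6:ℝ) / (64 * a ^ 3) := by
  wlog hy : 0 ≤ y generalizing y
  · have := this (-y) (by linarith)
    rw [abs_neg, neg_sq, show -y + a = -(y - a) by ring, show -y - a = -(y+a) by ring, abs_neg, abs_neg] at this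
    linarith
  have e : |y| ^ (6:ℝ) = y ^ 6 := by
    rw [abs_of_nonneg hy, show (6:ℝ) = ((6:ℕ):ℝ) by norm_num, rpow_natCast]
  rw [e, abs_of_nonneg (by linarith : 0 ≤ y + a)]
  rcases le_total y a with h | h
  · rw [abs_of_nonpos (by linarith)]
    have : 0 ≤ y ^ 6 / (64 * a ^ 3) := by positivity
    nlinarith
  · rw [abs_of_nonneg (by linarith)]
    have h1 : y - a ≤ y ^ 2 / (4 * a) := by
      rw [le_div_iff₀ (by positivity)]; nlinarith [sq_nonneg (y - 2 * a)]
    have h2 : (y - a) ^ 3 ≤ (y ^ 2 / (4 * a)) ^ 3 := by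
      gcongr
    have e2 : (y ^ 2 / (4 * a)) ^ 3 = y ^ 6 / (64 * a ^ 3) := by field_simp; ring
    rw [e2] at h2
    nlinarith

lemma gm_six : gm 6 = 15 := by
  unfold gm
  rw [show ((6:ℝ) + 1) / 2 = 1/2 + 1 + 1 + 1 by norm_num, Gamma_add_one (by norm_num), Gamma_add_one (by norm_num),
    Gamma_add_one (by norm_num), Gamma_one_half_eq, show (6:ℝ)/2 = ((3:ℕ):ℝ) by norm_num, rpow_natCast]
  have := sqrt_pos.2 pi_pos
  field_simp
  norm_num

lemma third_moment (m : ℕ) (a : Fin (m+1) → ℝ) (hs : ∑ i, a i ^ 2 = 1) (i0 : Fin (m+1))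
    (hi : 3/5 ≤ a i0 ^ 2) : ES (m+1) a (fun t => |t| ^ 3) ≤ 1.427 := by
  set A := |a i0| with hA
  have hA2 : A ^ 2 = a i0 ^ 2 := sq_abs _
  have hA0 : 0 < A := by
    rcases (abs_nonneg (a i0)).eq_or_lt with h | h
    · rw [hA, ← h] at hA2; norm_num at hA2; rw [← hA2] at hi; norm_num at hi
    · exact h
  rw [Fin.sum_univ_succAbove _ i0] at hs
  set b := ∑ i, a (i0.succAbove i) ^ 2 with hb
  have hb0 : 0 ≤ b := Finset.sum_nonneg fun i _ => sq_nonneg _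
  have hbA : b = 1 - A ^ 2 := by rw [hA2]; linarith
  rw [ES_succ m i0]
  have h1 : ES m (fun i => a (i0.succAbove i)) (fun t => (|t + a i0| ^ 3 + |t - a i0| ^ 3) / 2) ≤
      ES m (fun i => a (i0.succAbove i)) (fun t => A ^ 3 + (3 * A * (0 + t) ^ 2 + 1 / (64 * A ^ 3) * |t| ^ (6:ℝ))) := by
    apply ES_mono
    intro t
    have := cube_sym A t hA0
    have e : |t + A| ^ 3 + |t - A| ^ 3 = |t + a i0| ^ 3 + |t - a i0| ^ 3 := by
      rcases abs_choice (a i0) with h | h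
      · rw [hA, h]
      · rw [hA, h, sub_neg_eq_add, ← sub_eq_add_neg, add_comm]
    rw [e] at this
    rw [zero_add]
    refine this.trans (le_of_eq ?_)
    ring
  rw [ES_add, ES_add, ES_const, ES_mul, ES_mul, ES_sq] at h1
  have h6 := khin_A 6 (by norm_num) m (fun i => a (i0.succAbove i))
  rw [gm_six, show (6:ℝ)/2 = ((3:ℕ):ℝ) by norm_num, rpow_natCast] at h6
  simp only [← hb] at h1 h6
  refine h1.trans ?_
  have h7 : 1 / (64 * A ^ 3) * ES m (fun i => a (i0.succAbove i)) (fun t => |t| ^ (6:ℝ)) ≤ 1 / (64 * A ^ 3) * (15 * b ^ 3) := by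
    gcongr
  have h8 : A ^ 3 + (3 * A * b + 1 / (64 * A ^ 3) * (15 * b ^ 3)) ≤ 1.427 := by
    have hAl : 0.77459 ≤ A := by nlinarith
    have hAu : A ≤ 1 := by nlinarith
    have : 15 * b ^ 3 ≤ (1.427 - A ^ 3 - 3 * A * b) * (64 * A ^ 3) := by
      rw [hbA]
      obtain ⟨t, ht⟩ : ∃ t, A = 0.77459 + t := ⟨A - 0.77459, by ring⟩
      have ht0 : 0 ≤ t := by linarith
      have ht1 : t ≤ 0.22541 := by linarith
      rw [ht, ← sub_nonneg]
      ring_nf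
      positivity
    rw [one_div, inv_mul_eq_div]
    have := (div_le_iff₀ (by positivity)).2 this
    linarith
  linarith

lemma khin_B1 (q : ℝ) (h2 : 2 < q) (h3 : q ≤ 3) (m : ℕ) (a : Fin m → ℝ) (hs : ∑ i, a i ^ 2 = 1) (i0 : Fin m)
    (hi : 3/5 ≤ a i0 ^ 2) : ES m a (fun t => |t| ^ q) ≤ gm q := by
  obtain ⟨m, rfl⟩ : ∃ k, m = k + 1 := ⟨m - 1, by have := i0.pos; omega⟩
  have hm := third_moment m a hs i0 hi
  set r := q - 2 with hr
  have hg := gm_lower (r / 2) (by linarith) (by linarith)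
  rw [show 2 * (r/2) = r by ring, show 2 + r = q by rw [hr]; ring] at hg
  refine le_trans ?_ hg
  have hpt : ∀ t : ℝ, |t| ^ q ≤ (1.427:ℝ) ^ r * (1 - r) * (0 + t) ^ 2 + (1.427:ℝ) ^ r * (r / 1.427) * |t| ^ 3 := by
    intro t
    rcases eq_or_ne t 0 with rfl | ht
    · simp [zero_rpow (by linarith : q ≠ 0)]
    have htp : 0 < |t| := abs_pos.2 ht
    have hb := rpow_one_add_le_one_add_mul_self (s := |t| / 1.427 - 1) (p := r)
      (by have : 0 ≤ |t| / 1.427 := by positivity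
          linarith) (by linarith) (by linarith)
    rw [show 1 + (|t| / 1.427 - 1) = |t| / 1.427 by ring, div_rpow htp.le (by norm_num), div_le_iff₀ (by positivity)] at hb
    have e : |t| ^ q = |t| ^ r * t ^ 2 := by
      rw [← sq_abs t, ← rpow_natCast |t| 2, ← rpow_add htp, hr]; norm_num
    rw [e, zero_add, show |t| ^ 3 = |t| * t ^ 2 by rw [← sq_abs t]; ring]
    calc |t| ^ r * t ^ 2 ≤ ((1 + r * (|t| / 1.427 - 1)) * 1.427 ^ r) * t ^ 2 := by gcongr
      _ = _ := by ring
  have h := ES_mono (m+1) a _ _ hpt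
  rw [ES_add, ES_mul, ES_mul, ES_sq, hs] at h
  refine h.trans ?_
  have hc : 0 < (1.427:ℝ) ^ r := by positivity
  have hr0 : 0 < r := by linarith
  calc (1.427:ℝ) ^ r * (1 - r) * (0 ^ 2 + 1) + 1.427 ^ r * (r / 1.427) * ES (m+1) a (fun t => |t| ^ 3)
      ≤ (1.427:ℝ) ^ r * (1 - r) * (0 ^ 2 + 1) + 1.427 ^ r * (r / 1.427) * 1.427 := by gcongr
    _ = (1.427:ℝ) ^ r := by ring

end

section

noncomputable def kf (δ a x : ℝ) : ℝ := (cos (a / √x) - 1 + a ^ 2 / (2 * x)) * x ^ δ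

lemma kf_nonneg (δ a x : ℝ) (hx : 0 < x) : 0 ≤ kf δ a x := by
  unfold kf
  have h := Real.one_sub_sq_div_two_le_cos (x := a / √x)
  rw [div_pow, sq_sqrt hx.le, div_div, mul_comm x 2] at h
  have : 0 ≤ x ^ δ := rpow_nonneg hx.le _
  apply mul_nonneg _ this
  linarith

lemma cos_le_quartic (u : ℝ) : cos u ≤ 1 - u ^ 2 / 2 + u ^ 4 / 24 := by
  wlog hu : 0 ≤ u generalizing u
  · have := this (-u) (by linarith)
    rw [cos_neg] at this
    nlinarith
  have hs : ∀ v, 0 ≤ v → v - v ^ 3 / 6 ≤ sin v := fun v hv => Real.sin_ge_sub_cube hv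
  let F : ℝ → ℝ := fun u => 1 - u ^ 2 / 2 + u ^ 4 / 24 - cos u
  have hF : ∀ u, HasDerivAt F (-u + u ^ 3 / 6 + sin u) u := by
    intro u
    have h1 := (((hasDerivAt_pow 2 u).div_const 2).const_sub 1).add ((hasDerivAt_pow 4 u).div_const 24)
    refine (h1.sub (hasDerivAt_cos u)).congr_deriv ?_
    norm_num; ring
  have : MonotoneOn F (Set.Ici 0) := by
    refine monotoneOn_of_deriv_nonneg (convex_Ici 0) (fun t _ => (hF t).continuousAt.continuousWithinAt)
      (fun t _ => (hF t).differentiableAt.differentiableWithinAt) ?_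
    intro x hx
    rw [interior_Ici] at hx
    rw [(hF x).deriv]
    have := hs x (le_of_lt hx)
    linarith
  have h := this (Set.mem_Ici.2 le_rfl) (Set.mem_Ici.2 hu) hu
  simp only [F] at h
  norm_num at h
  linarith

lemma kf_meas (δ : ℝ) : Measurable (fun p : ℝ × ℝ => kf δ p.1 p.2) := by
  unfold kf; fun_prop

open MeasureTheory in
lemma kf_integrable (δ a : ℝ) (h0 : 0 < δ) (h1 : δ < 1) : IntegrableOn (kf δ a) (Set.Ioi 0) := by
  have hm : Measurable (kf δ a) := by unfold kf; fun_prop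
  rw [← Set.Ioc_union_Ioi_eq_Ioi zero_le_one]
  apply IntegrableOn.union
  · have hi : IntegrableOn (fun x : ℝ => a ^ 2 / 2 * x ^ (δ - 1)) (Set.Ioc 0 1) := by
      have := (intervalIntegral.intervalIntegrable_rpow' (a := 0) (b := 1) (by linarith : -1 < δ - 1)).1
      exact this.const_mul _
    refine hi.mono' hm.aestronglyMeasurable ?_
    filter_upwards [self_mem_ae_restrict measurableSet_Ioc] with x hx
    rw [Real.norm_of_nonneg (kf_nonneg δ a x hx.1)]
    unfold kf
    rw [rpow_sub_one hx.1.ne']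
    have := cos_le_one (a / √x)
    have hp : 0 < x ^ δ := rpow_pos_of_pos hx.1 _
    calc (cos (a / √x) - 1 + a ^ 2 / (2 * x)) * x ^ δ ≤ (a ^ 2 / (2 * x)) * x ^ δ := by
          gcongr; linarith
      _ = _ := by field_simp
  · have hi : IntegrableOn (fun x : ℝ => a ^ 4 / 24 * x ^ (δ - 2)) (Set.Ioi 1) :=
      (integrableOn_Ioi_rpow_of_lt (by linarith) one_pos).const_mul _
    refine hi.mono' hm.aestronglyMeasurable ?_
    filter_upwards [self_mem_ae_restrict measurableSet_Ioi] with x hx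
    have hx0 : 0 < x := lt_trans one_pos hx
    rw [Real.norm_of_nonneg (kf_nonneg δ a x hx0)]
    unfold kf
    have := cos_le_quartic (a / √x)
    rw [div_pow, div_pow, show √x ^ 4 = (√x ^ 2) ^ 2 by ring, sq_sqrt hx0.le] at this
    have hp : 0 < x ^ δ := rpow_pos_of_pos hx0 _
    rw [rpow_sub hx0, rpow_two]
    calc (cos (a / √x) - 1 + a ^ 2 / (2 * x)) * x ^ δ ≤ (a ^ 4 / x ^ 2 / 24) * x ^ δ := by
          gcongr
          have e : a ^ 2 / x / 2 = a ^ 2 / (2 * x) := by field_simp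
          linarith
      _ = _ := by field_simp

open MeasureTheory in
noncomputable def KK (δ : ℝ) : ℝ := ∫ x in Set.Ioi (0:ℝ), kf δ 1 x

open MeasureTheory in
lemma KK_pos (δ : ℝ) (h0 : 0 < δ) (h1 : δ < 1) : 0 < KK δ := by
  unfold KK
  rw [setIntegral_pos_iff_support_of_nonneg_ae _ (kf_integrable δ 1 h0 h1)]
  · have hsub : Set.Ioo (0:ℝ) (1/4) ⊆ Function.support (kf δ 1) ∩ Set.Ioi 0 := by
      intro x hx
      refine ⟨?_, hx.1⟩
      have hp : 0 < x ^ δ := rpow_pos_of_pos hx.1 _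
      have : 0 < kf δ 1 x := by
        unfold kf
        apply mul_pos _ hp
        have := neg_one_le_cos (1 / √x)
        have h2 : 2 < 1 ^ 2 / (2 * x) := by
          rw [lt_div_iff₀ (by linarith [hx.1])]; linarith [hx.2]
        linarith
      exact this.ne'
    refine lt_of_lt_of_le ?_ (measure_mono hsub)
    simp
  · filter_upwards [self_mem_ae_restrict measurableSet_Ioi] with x hx
    exact kf_nonneg δ 1 x hx

open MeasureTheory in
lemma kf_scale (δ a : ℝ) (h0 : 0 < δ) (h1 : δ < 1) :
    ∫ x in Set.Ioi (0:ℝ), kf δ a x = |a| ^ (2 + 2 * δ) * KK δ := by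
  rcases eq_or_ne a 0 with rfl | ha
  · simp [kf, zero_rpow (by linarith : 2 + 2 * δ ≠ 0)]
  have ha2 : 0 < (a ^ 2)⁻¹ := by positivity
  have h := integral_comp_mul_left_Ioi (kf δ 1) 0 ha2
  rw [mul_zero, inv_inv] at h
  have hb : 0 < |a| := abs_pos.2 ha
  have e : ∫ x in Set.Ioi (0:ℝ), kf δ 1 ((a ^ 2)⁻¹ * x) = ∫ x in Set.Ioi (0:ℝ), |a| ^ (-(2 * δ)) * kf δ a x := by
    refine setIntegral_congr_fun measurableSet_Ioi fun x hx => ?_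
    have hx : 0 < x := hx
    simp only [kf]
    have e1 : √((a ^ 2)⁻¹ * x) = √x / |a| := by
      rw [sqrt_mul (by positivity), sqrt_inv, sqrt_sq_eq_abs]; field_simp
    have e2 : cos (1 / √((a ^ 2)⁻¹ * x)) = cos (a / √x) := by
      rw [e1, one_div_div]
      rcases abs_choice a with h | h
      · rw [h]
      · rw [h, neg_div, cos_neg]
    have e3 : ((a ^ 2)⁻¹ * x) ^ δ = |a| ^ (-(2 * δ)) * x ^ δ := by
      rw [mul_rpow (by positivity) hx.le, ← sq_abs, ← rpow_natCast, ← rpow_neg hb.le, ← rpow_mul hb.le]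
      congr 2; push_cast; ring
    rw [e2, e3]
    have e4 : (1:ℝ) ^ 2 / (2 * ((a ^ 2)⁻¹ * x)) = a ^ 2 / (2 * x) := by field_simp
    rw [e4]; ring
  rw [e, integral_const_mul, smul_eq_mul] at h
  unfold KK
  rw [rpow_add hb, rpow_two, sq_abs, mul_right_comm, ← h, rpow_neg hb.le]
  have : 0 < |a| ^ (2 * δ) := rpow_pos_of_pos hb _
  field_simp

open MeasureTheory ProbabilityTheory in
lemma gauss_cos (τ : ℝ) : ∫ z, cos (τ * z) ∂(gaussianReal 0 1) = exp (-τ ^ 2 / 2) := by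
  have h := charFun_gaussianReal (μ := 0) (v := 1) τ
  rw [charFun_apply_real] at h
  have h2 := congrArg Complex.re h
  have hi : Integrable (fun x : ℝ => Complex.exp (τ * x * Complex.I)) (gaussianReal 0 1) := by
    refine (integrable_const (1:ℝ)).mono' (by fun_prop) ?_
    filter_upwards with x
    rw [← Complex.ofReal_mul, Complex.norm_exp_ofReal_mul_I]
  have h3 := integral_re hi
  simp only [RCLike.re_eq_complex_re] at h3
  rw [← h3] at h2
  have e1 : ∀ x : ℝ, (Complex.exp (τ * x * Complex.I)).re = cos (τ * x) := by
    intro x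
    rw [← Complex.ofReal_mul, Complex.exp_ofReal_mul_I_re]
  simp only [e1] at h2
  rw [h2]
  have : (τ * (0:ℝ) * Complex.I - ((1:NNReal):ℝ) * (τ:ℂ) ^ 2 / 2 : ℂ) = ((-τ ^ 2 / 2 : ℝ) : ℂ) := by
    push_cast; ring
  rw [this, Complex.exp_ofReal_re]

open MeasureTheory ProbabilityTheory in
lemma gauss_kf (δ x : ℝ) (hx : 0 < x) :
    ∫ z, kf δ z x ∂(gaussianReal 0 1) = (exp (-(1 / (2 * x))) - 1 + 1 / (2 * x)) * x ^ δ := by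
  unfold kf
  rw [integral_mul_const]
  congr 1
  have i1 : Integrable (fun z : ℝ => cos (z / √x)) (gaussianReal 0 1) := by
    refine (integrable_const (1:ℝ)).mono' (by fun_prop) ?_
    filter_upwards with z
    exact abs_cos_le_one _
  have i2 : Integrable (fun z : ℝ => z ^ 2) (gaussianReal 0 1) := by
    have := gauss_abs_rpow_integrable 2 (by norm_num) 0 1
    simpa using this
  have m2 : ∫ z, z ^ 2 ∂(gaussianReal 0 1) = 1 := by
    have := gauss_moment 2 (by norm_num)
    have g2 : gm 2 = 1 := by
      have := gm_eq 0
      simp at this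
      rw [this, div_self]
      exact (Real.Gamma_pos_of_pos (by norm_num)).ne'
    rw [g2] at this
    simpa using this
  have i3 : Integrable (fun z : ℝ => cos (z / √x) - 1) (gaussianReal 0 1) := i1.sub (integrable_const _)
  rw [integral_add i3 (i2.div_const _), integral_sub i1 (integrable_const _),
    integral_div, m2]
  have := gauss_cos (1 / √x)
  simp only [one_div_mul_eq_div] at this
  rw [this]
  simp [sq_sqrt hx.le]
  field_simp

open MeasureTheory ProbabilityTheory in
lemma gauss_fourier (δ : ℝ) (h0 : 0 < δ) (h1 : δ < 1) :
    IntegrableOn (fun x => (exp (-(1 / (2 * x))) - 1 + 1 / (2 * x)) * x ^ δ) (Set.Ioi 0) ∧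
    ∫ x in Set.Ioi (0:ℝ), (exp (-(1 / (2 * x))) - 1 + 1 / (2 * x)) * x ^ δ = gm (2 + 2 * δ) * KK δ := by
  have hprodI : Integrable (fun p : ℝ × ℝ => kf δ p.1 p.2) ((gaussianReal 0 1).prod (volume.restrict (Set.Ioi 0))) := by
    rw [integrable_prod_iff (kf_meas δ).aestronglyMeasurable]
    refine ⟨Filter.Eventually.of_forall fun z => kf_integrable δ z h0 h1, ?_⟩
    have e : ∀ z, ∫ x in Set.Ioi (0:ℝ), ‖kf δ z x‖ = |0 + z| ^ (2 + 2 * δ) * KK δ := by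
      intro z
      rw [zero_add, ← kf_scale δ z h0 h1]
      refine setIntegral_congr_fun measurableSet_Ioi fun x hx => ?_
      exact Real.norm_of_nonneg (kf_nonneg δ z x hx)
    simp only [e]
    exact (gauss_abs_rpow_integrable (2 + 2 * δ) (by linarith) 0 1).mul_const _
  have hsw := integral_integral_swap (f := fun z x => kf δ z x) hprodI
  have hr := hprodI.integral_prod_right
  have ec : ∀ x ∈ Set.Ioi (0:ℝ), ∫ z, kf δ z x ∂(gaussianReal 0 1) = (exp (-(1 / (2 * x))) - 1 + 1 / (2 * x)) * x ^ δ :=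
    fun x hx => gauss_kf δ x hx
  constructor
  · exact IntegrableOn.congr_fun (f := fun x => ∫ z, kf δ z x ∂(gaussianReal 0 1)) hr ec measurableSet_Ioi
  · rw [← setIntegral_congr_fun measurableSet_Ioi ec, ← hsw]
    simp only [kf_scale δ _ h0 h1]
    rw [integral_mul_const, gauss_moment _ (by linarith)]

open MeasureTheory in
lemma rad_fourier (δ : ℝ) (h0 : 0 < δ) (h1 : δ < 1) (m : ℕ) (a : Fin m → ℝ) (hs : ∑ i, a i ^ 2 = 1) :
    IntegrableOn (fun x => ((∏ i, cos (a i / √x)) - 1 + 1 / (2 * x)) * x ^ δ) (Set.Ioi 0) ∧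
    ∫ x in Set.Ioi (0:ℝ), ((∏ i, cos (a i / √x)) - 1 + 1 / (2 * x)) * x ^ δ = 
      ES m a (fun t => |t| ^ (2 + 2 * δ)) * KK δ := by
  obtain ⟨hI, hE⟩ := ES_integral m a (volume.restrict (Set.Ioi (0:ℝ))) (fun t x => kf δ t x) (fun t => kf_integrable δ t h0 h1)
  have ec : ∀ x : ℝ, ES m a (fun t => kf δ t x) = ((∏ i, cos (a i / √x)) - 1 + 1 / (2 * x)) * x ^ δ := by
    intro x
    have : (fun t => kf δ t x) = fun t => x ^ δ * (cos (1 / √x * (0 + t)) + (1 / (2 * x) * (0 + t) ^ 2 + (-1))) := by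
      funext t
      unfold kf
      rw [zero_add, one_div_mul_eq_div]; ring
    rw [this, ES_mul, ES_add, ES_add, ES_const, ES_mul, ES_sq, ES_cos, hs]
    simp only [one_div_mul_eq_div, mul_zero, cos_zero]
    ring
  simp only [ec] at hI hE
  refine ⟨hI, ?_⟩
  rw [← hE, mul_comm, ← ES_mul]
  congr 1
  funext t
  rw [kf_scale δ t h0 h1, mul_comm]

open MeasureTheory in
lemma khin_of_minorants (δ : ℝ) (h0 : 0 < δ) (h1 : δ < 1) (m : ℕ) (a : Fin m → ℝ) (hs : ∑ i, a i ^ 2 = 1)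
    (hN : ∀ i, ∃ N : ℝ → ℝ, IntegrableOn N (Set.Ioi 0) ∧ 0 ≤ ∫ x in Set.Ioi (0:ℝ), N x ∧
      ∀ x, 0 < x → N x ≤ a i ^ 2 * (exp (-(1 / (2 * x))) - |cos (a i / √x)| ^ (1 / a i ^ 2)) * x ^ δ) :
    ES m a (fun t => |t| ^ (2 + 2 * δ)) ≤ gm (2 + 2 * δ) := by
  choose N hNi hN0 hNl using hN
  obtain ⟨gI, gE⟩ := gauss_fourier δ h0 h1
  obtain ⟨rI, rE⟩ := rad_fourier δ h0 h1 m a hs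
  have hK := KK_pos δ h0 h1
  have hmain : 0 ≤ ∫ x in Set.Ioi (0:ℝ), ((exp (-(1 / (2 * x))) - 1 + 1 / (2 * x)) * x ^ δ -
      ((∏ i, cos (a i / √x)) - 1 + 1 / (2 * x)) * x ^ δ) := by
    have hle : ∫ x in Set.Ioi (0:ℝ), ∑ i, N i x ≤ ∫ x in Set.Ioi (0:ℝ), ((exp (-(1 / (2 * x))) - 1 + 1 / (2 * x)) * x ^ δ -
      ((∏ i, cos (a i / √x)) - 1 + 1 / (2 * x)) * x ^ δ) := by
      refine setIntegral_mono_on (integrable_finsetSum _ fun i _ => hNi i) (gI.sub rI) measurableSet_Ioi fun x hx => ?_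
      have hx : 0 < x := hx
      have hp : 0 < x ^ δ := rpow_pos_of_pos hx _
      have hsum : ∑ i, N i x ≤ ∑ i, a i ^ 2 * (exp (-(1 / (2 * x))) - |cos (a i / √x)| ^ (1 / a i ^ 2)) * x ^ δ :=
        Finset.sum_le_sum fun i _ => hNl i x hx
      refine hsum.trans ?_
      rw [← Finset.sum_mul, ← sub_mul]
      gcongr
      have hg := Real.geom_mean_le_arith_mean_weighted Finset.univ (fun i => a i ^ 2)
        (fun i => |cos (a i / √x)| ^ (1 / a i ^ 2)) (fun i _ => sq_nonneg _) hs (fun i _ => rpow_nonneg (abs_nonneg _) _)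
      have e1 : ∀ i, (|cos (a i / √x)| ^ (1 / a i ^ 2)) ^ (a i ^ 2) = |cos (a i / √x)| := by
        intro i
        rcases eq_or_ne (a i) 0 with h | h
        · simp [h]
        · rw [← rpow_mul (abs_nonneg _), one_div_mul_cancel (by positivity), rpow_one]
      simp only [e1] at hg
      have h3 : ∏ i, cos (a i / √x) ≤ ∏ i, |cos (a i / √x)| := by
        rw [← Finset.abs_prod]; exact le_abs_self _
      simp only [mul_sub, Finset.sum_sub_distrib]
      rw [← Finset.sum_mul, hs]
      linarith
    refine le_trans ?_ hle
    rw [integral_finsetSum _ fun i _ => hNi i]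
    exact Finset.sum_nonneg fun i _ => hN0 i
  rw [integral_sub gI rI, gE, rE, ← sub_mul] at hmain
  have := nonneg_of_mul_nonneg_left hmain hK
  linarith

open MeasureTheory in
lemma khin_B2 (δ : ℝ) (h0 : 0 < δ) (h1 : δ < 1)
    (hH : ∀ s : ℝ, 5/3 ≤ s → ∃ M : ℝ → ℝ, IntegrableOn M (Set.Ioi 0) ∧ 0 ≤ ∫ x in Set.Ioi (0:ℝ), M x ∧
      ∀ x, 0 < x → M x ≤ (exp (-(s / (2 * x))) - |cos (1 / √x)| ^ s) * x ^ δ)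
    (m : ℕ) (a : Fin m → ℝ) (hs : ∑ i, a i ^ 2 = 1) (ha : ∀ i, a i ^ 2 ≤ 3/5) :
    ES m a (fun t => |t| ^ (2 + 2 * δ)) ≤ gm (2 + 2 * δ) := by
  refine khin_of_minorants δ h0 h1 m a hs fun i => ?_
  rcases eq_or_ne (a i) 0 with h | h
  · exact ⟨0, integrableOn_zero, by simp, fun x _ => by simp [h]⟩
  have ha2 : 0 < a i ^ 2 := by positivity
  have hb : 0 < |a i| := abs_pos.2 h
  set s := 1 / a i ^ 2 with hsd
  have hs0 : 0 < s := by positivity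
  obtain ⟨M, hM1, hM2, hM3⟩ := hH s (by
    rw [hsd, le_div_iff₀ ha2]; have := ha i; linarith)
  refine ⟨fun x => a i ^ 2 * |a i| ^ (2 * δ) * M (s * x), ?_, ?_, ?_⟩
  · have := (integrableOn_Ioi_comp_mul_left_iff M 0 hs0).2 (by rwa [mul_zero])
    exact this.const_mul _
  · rw [integral_const_mul, integral_comp_mul_left_Ioi _ _ hs0, mul_zero]
    have : 0 ≤ |a i| ^ (2 * δ) := rpow_nonneg (abs_nonneg _) _
    simp only [smul_eq_mul]
    positivity
  · intro x hx
    have h3 := hM3 (s * x) (by positivity)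
    have e1 : s / (2 * (s * x)) = 1 / (2 * x) := by field_simp
    have e2 : |cos (1 / √(s * x))| = |cos (a i / √x)| := by
      have : √(s * x) = √x / |a i| := by
        rw [hsd, sqrt_mul (by positivity), sqrt_div (by norm_num), sqrt_one, sqrt_sq_eq_abs]; field_simp
      rw [this, one_div_div]
      rcases abs_choice (a i) with h | h
      · rw [h]
      · rw [h, neg_div, cos_neg]
    have e3 : (s * x) ^ δ = |a i| ^ (-(2 * δ)) * x ^ δ := by
      rw [mul_rpow hs0.le hx.le, hsd, one_div, ← sq_abs, ← rpow_natCast, ← rpow_neg hb.le, ← rpow_mul hb.le]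
      congr 2; push_cast; ring
    rw [e1, e2, e3, rpow_neg hb.le] at h3
    have hp : 0 < |a i| ^ (2 * δ) := rpow_pos_of_pos hb _
    calc a i ^ 2 * |a i| ^ (2 * δ) * M (s * x) ≤ a i ^ 2 * |a i| ^ (2 * δ) *
          ((exp (-(1 / (2 * x))) - |cos (a i / √x)| ^ s) * ((|a i| ^ (2 * δ))⁻¹ * x ^ δ)) := by gcongr
      _ = _ := by field_simp

end

section

lemma le_of_deriv_le_Ici {f g f' g' : ℝ → ℝ} (hf : ∀ x, HasDerivAt f (f' x) x) (hg : ∀ x, HasDerivAt g (g' x) x)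
    (h0 : f 0 ≤ g 0) (h : ∀ x, 0 ≤ x → f' x ≤ g' x) (x : ℝ) (hx : 0 ≤ x) : f x ≤ g x := by
  have hd : ∀ t, HasDerivAt (fun t => g t - f t) (g' t - f' t) t := fun t => (hg t).sub (hf t)
  have : MonotoneOn (fun t => g t - f t) (Set.Ici 0) := by
    refine monotoneOn_of_deriv_nonneg (convex_Ici 0) (fun t _ => (hd t).continuousAt.continuousWithinAt)
      (fun t _ => (hd t).differentiableAt.differentiableWithinAt) ?_
    intro t ht
    rw [interior_Ici] at ht
    rw [(hd t).deriv]
    have := h t (le_of_lt ht)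
    linarith
  have h2 := this (Set.mem_Ici.2 le_rfl) (Set.mem_Ici.2 hx) hx
  simp only at h2
  linarith

lemma sin_le5 (u : ℝ) (hu : 0 ≤ u) : sin u ≤ u - u ^ 3 / 6 + u ^ 5 / 120 := by
  refine le_of_deriv_le_Ici (g := fun u => u - u ^ 3 / 6 + u ^ 5 / 120) (g' := fun u => 1 - u ^ 2 / 2 + u ^ 4 / 24)
    hasDerivAt_sin (fun x => ?_) (by simp) (fun x _ => cos_le_quartic x) u hu
  have h1 := ((hasDerivAt_id' x).sub ((hasDerivAt_pow 3 x).div_const 6)).add ((hasDerivAt_pow 5 x).div_const 120)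
  refine h1.congr_deriv ?_
  norm_num; ring

lemma cos_ge6 (u : ℝ) (hu : 0 ≤ u) : 1 - u ^ 2 / 2 + u ^ 4 / 24 - u ^ 6 / 720 ≤ cos u := by
  refine le_of_deriv_le_Ici (f := fun u => 1 - u ^ 2 / 2 + u ^ 4 / 24 - u ^ 6 / 720)
    (f' := fun u => - (u - u ^ 3 / 6 + u ^ 5 / 120))
    (fun x => ?_) hasDerivAt_cos (by simp) (fun x hx => neg_le_neg (sin_le5 x hx)) u hu
  have h1 := ((((hasDerivAt_pow 2 x).div_const 2).const_sub 1).add ((hasDerivAt_pow 4 x).div_const 24)).sub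
    ((hasDerivAt_pow 6 x).div_const 720)
  refine h1.congr_deriv ?_
  norm_num; ring

lemma sin_ge7 (u : ℝ) (hu : 0 ≤ u) : u - u ^ 3 / 6 + u ^ 5 / 120 - u ^ 7 / 5040 ≤ sin u := by
  refine le_of_deriv_le_Ici (f := fun u => u - u ^ 3 / 6 + u ^ 5 / 120 - u ^ 7 / 5040)
    (f' := fun u => 1 - u ^ 2 / 2 + u ^ 4 / 24 - u ^ 6 / 720)
    (fun x => ?_) hasDerivAt_sin (by simp) (fun x hx => cos_ge6 x hx) u hu
  have h1 := (((hasDerivAt_id' x).sub ((hasDerivAt_pow 3 x).div_const 6)).add ((hasDerivAt_pow 5 x).div_const 120)).sub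
    ((hasDerivAt_pow 7 x).div_const 5040)
  refine h1.congr_deriv ?_
  norm_num; ring

lemma pi_sq_lt : π ^ 2 < 9.8698 := by
  have := Real.pi_lt_d6
  have := Real.pi_pos
  nlinarith

lemma lt_pi_sq : 9.8695 < π ^ 2 := by
  have := Real.pi_gt_d6
  nlinarith

lemma cos_le_exp_W (u : ℝ) (hu0 : 0 ≤ u) (hu : u ≤ π / 2) :
    cos u ≤ exp (-(u ^ 2 / (1 - u ^ 2 / 6 - u ^ 4 / 60) / 2)) := by
  have hpi := pi_sq_lt
  have hv : ∀ u : ℝ, 0 ≤ u → u ≤ π / 2 → u ^ 2 ≤ 2.46745 := by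
    intro u h0 h1
    nlinarith [Real.pi_pos]
  have hN : ∀ u : ℝ, 0 ≤ u → u ≤ π / 2 → 0 < 1 - u ^ 2 / 6 - u ^ 4 / 60 := by
    intro u h0 h1
    have := hv u h0 h1
    nlinarith [sq_nonneg u]
  set E : ℝ → ℝ := fun u => cos u * exp (u ^ 2 / (1 - u ^ 2 / 6 - u ^ 4 / 60) / 2) with hE
  have hd : ∀ u : ℝ, 0 ≤ u → u ≤ π / 2 → HasDerivAt E
      (exp (u ^ 2 / (1 - u ^ 2 / 6 - u ^ 4 / 60) / 2) / (1 - u ^ 2 / 6 - u ^ 4 / 60) ^ 2 *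
        (u * cos u * (1 + u ^ 4 / 60) - sin u * (1 - u ^ 2 / 6 - u ^ 4 / 60) ^ 2)) u := by
    intro u h0 h1
    have hNu := hN u h0 h1
    have hNd : HasDerivAt (fun u : ℝ => 1 - u ^ 2 / 6 - u ^ 4 / 60) (-(u / 3) - u ^ 3 / 15) u := by
      refine ((((hasDerivAt_pow 2 u).div_const 6).const_sub 1).sub ((hasDerivAt_pow 4 u).div_const 60)).congr_deriv ?_
      norm_num; ring
    have hW := (((hasDerivAt_pow 2 u).div hNd hNu.ne').div_const 2).exp
    refine ((hasDerivAt_cos u).mul hW).congr_deriv ?_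
    simp only [Pi.div_apply]
    set X := exp (u ^ 2 / (1 - u ^ 2 / 6 - u ^ 4 / 60) / 2)
    generalize hNN : 1 - u ^ 2 / 6 - u ^ 4 / 60 = n at *
    have hn0 := hNu.ne'
    field_simp
    rw [← hNN]
    norm_num
    ring
  have hanti : AntitoneOn E (Set.Icc 0 (π/2)) := by
    refine antitoneOn_of_deriv_nonpos (convex_Icc _ _) (fun t ht => (hd t ht.1 ht.2).continuousAt.continuousWithinAt)
      (fun t ht => ?_) ?_
    · have ht := interior_subset ht
      exact (hd t ht.1 ht.2).differentiableAt.differentiableWithinAt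
    · intro t ht
      have ht := interior_subset ht
      rw [(hd t ht.1 ht.2).deriv]
      have hNt := hN t ht.1 ht.2
      apply mul_nonpos_of_nonneg_of_nonpos (by positivity)
      have h1 := sin_ge7 t ht.1
      have h2 := cos_le_quartic t
      have ht0 := ht.1
      have hvt := hv t ht.1 ht.2
      have a1 : t * cos t * (1 + t ^ 4 / 60) ≤ t * (1 - t ^ 2 / 2 + t ^ 4 / 24) * (1 + t ^ 4 / 60) := by gcongr
      have a2 : (t - t ^ 3 / 6 + t ^ 5 / 120 - t ^ 7 / 5040) * (1 - t ^ 2 / 6 - t ^ 4 / 60) ^ 2 ≤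
        sin t * (1 - t ^ 2 / 6 - t ^ 4 / 60) ^ 2 := by gcongr
      have a3 : t * (1 - t ^ 2 / 2 + t ^ 4 / 24) * (1 + t ^ 4 / 60) ≤
          (t - t ^ 3 / 6 + t ^ 5 / 120 - t ^ 7 / 5040) * (1 - t ^ 2 / 6 - t ^ 4 / 60) ^ 2 := by
        rw [← sub_nonneg]
        obtain ⟨v, hv⟩ : ∃ v, v = t ^ 2 := ⟨_, rfl⟩
        have hv0 : 0 ≤ v := by rw [hv]; positivity
        rw [← hv] at hvt
        have e : (t - t ^ 3 / 6 + t ^ 5 / 120 - t ^ 7 / 5040) * (1 - t ^ 2 / 6 - t ^ 4 / 60) ^ 2 -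
          t * (1 - t ^ 2 / 2 + t ^ 4 / 24) * (1 + t ^ 4 / 60) = t * v ^ 3 * (179/15120 - v/756 + v^2/907200 + 11/9072000*v^3 - v^4 / 18144000) := by
          rw [hv]; ring
        rw [e]
        apply mul_nonneg (by positivity)
        have : v ^ 4 ≤ 3 * v ^ 3 := by
          rw [pow_succ, mul_comm]; gcongr; linarith
        have : 0 ≤ v ^ 3 := by positivity
        have : 0 ≤ v ^ 2 := by positivity
        linarith
      linarith
  have h := hanti ⟨le_rfl, by positivity⟩ ⟨hu0, hu⟩ hu0
  simp only [hE] at h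
  norm_num at h
  rw [exp_neg, ← one_div, le_div_iff₀ (exp_pos _)]
  exact h

lemma cos_le_G (x c : ℝ) (hx : 4 / π ^ 2 ≤ x) (hc : c ≤ 1/6 + 1/(60 * x)) (hcx : c < x) :
    cos (1 / √x) ≤ exp (-(1 / (2 * (x - c)))) := by
  have hx0 : 0 < x := lt_of_lt_of_le (by positivity) hx
  have hsx : 0 < √x := sqrt_pos.2 hx0
  have h2 : 2 / π ≤ √x := by
    apply Real.le_sqrt_of_sq_le
    rw [div_pow]; norm_num; exact hx
  have hu : 1 / √x ≤ π / 2 := by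
    rw [div_le_div_iff₀ hsx (by norm_num)]
    rw [div_le_iff₀ pi_pos] at h2
    linarith
  refine (cos_le_exp_W _ (by positivity) hu).trans ?_
  apply exp_le_exp.2
  apply neg_le_neg
  have e2 : (1 / √x) ^ 2 = 1 / x := by rw [div_pow, sq_sqrt hx0.le, one_pow]
  rw [show (1 / √x) ^ 4 = ((1 / √x) ^ 2) ^ 2 by ring, e2]
  have hpi := pi_sq_lt
  have hx4 : 0.405 < x := by
    refine lt_of_lt_of_le ?_ hx
    rw [lt_div_iff₀ (by positivity)]; linarith
  have hpos : 0 < x - 1/6 - 1/(60 * x) := by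
    have : 1 / (60 * x) < 1/20 := by
      rw [div_lt_div_iff₀ (by positivity) (by norm_num)]; linarith
    linarith
  have e3 : 1 / x / (1 - 1 / x / 6 - (1 / x) ^ 2 / 60) / 2 = 1 / (2 * (x - 1/6 - 1/(60 * x))) := by
    have hd : 1 - 1 / x / 6 - (1 / x) ^ 2 / 60 = (x - 1/6 - 1/(60 * x)) / x := by field_simp
    rw [hd]
    field_simp
  rw [e3]
  apply one_div_le_one_div_of_le (by linarith)
  linarith

end

section

lemma kernel_tele (c : ℝ) (hc : 3/2 ≤ c) :
    1 / c ^ 3 ≤ 1/2 * (1 / (c ^ 2 - c + 0.45) - 1 / (c ^ 2 + c + 0.45)) := by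
  have h1 : 0 < c ^ 2 - c + 0.45 := by nlinarith
  have h2 : 0 < c ^ 2 + c + 0.45 := by nlinarith
  have e : 1/2 * (1 / (c ^ 2 - c + 0.45) - 1 / (c ^ 2 + c + 0.45)) = c / ((c ^ 2 - c + 0.45) * (c ^ 2 + c + 0.45)) := by
    rw [div_sub_div _ _ h1.ne' h2.ne', mul_div_assoc', div_eq_div_iff (by positivity) (by positivity)]
    ring
  rw [e, div_le_div_iff₀ (by positivity) (by positivity)]
  nlinarith

lemma kernel_sum (y : ℝ) (hy : -(1/2) ≤ y) (N : ℕ) :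
    ∑ k ∈ Finset.range N, 1 / ((k:ℝ) + 2 + y) ^ 3 ≤ 1/2 * (1 / (y ^ 2 + 3 * y + 2.45)) := by
  have h : ∑ k ∈ Finset.range N, 1 / ((k:ℝ) + 2 + y) ^ 3 ≤
      1/2 * (1 / (y ^ 2 + 3 * y + 2.45)) - 1/2 * (1 / (((N:ℝ) + 2 + y) ^ 2 - ((N:ℝ) + 2 + y) + 0.45)) := by
    induction N with
    | zero =>
      simp only [Finset.range_zero, Finset.sum_empty, Nat.cast_zero, zero_add]
      rw [show (2 + y) ^ 2 - (2 + y) + 0.45 = y ^ 2 + 3 * y + 2.45 by ring]; simp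
    | succ n ih =>
      rw [Finset.sum_range_succ]
      have hn : (0:ℝ) ≤ n := Nat.cast_nonneg n
      have := kernel_tele ((n:ℝ) + 2 + y) (by linarith)
      push_cast
      rw [show ((n:ℝ) + 1 + 2 + y) ^ 2 - ((n:ℝ) + 1 + 2 + y) + 0.45 = ((n:ℝ) + 2 + y) ^ 2 + ((n:ℝ) + 2 + y) + 0.45 by ring]
      linarith
  have hn : (0:ℝ) ≤ N := Nat.cast_nonneg N
  have : 0 < ((N:ℝ) + 2 + y) ^ 2 - ((N:ℝ) + 2 + y) + 0.45 := by nlinarith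
  have : 0 ≤ 1/2 * (1 / (((N:ℝ) + 2 + y) ^ 2 - ((N:ℝ) + 2 + y) + 0.45)) := by positivity
  linarith

noncomputable def hker (y : ℝ) : ℝ := 1 / (1 + y) ^ 3 + 1/2 * (1 / (y ^ 2 + 3 * y + 2.45))

lemma hker_sym (y : ℝ) (h0 : 0 ≤ y) (h1 : y ≤ 1/2) :
    hker y + hker (-y) ≤ 2.43 + 11.2 * y ^ 2 + 58 * y ^ 4 := by
  unfold hker
  obtain ⟨z, hz⟩ : ∃ z, z = y ^ 2 := ⟨_, rfl⟩
  have hz0 : 0 ≤ z := by rw [hz]; positivity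
  have hz1 : z ≤ 1/4 := by rw [hz]; nlinarith
  have d1 : 0 < y ^ 2 + 3 * y + 2.45 := by positivity
  have d2 : 0 < (-y) ^ 2 + 3 * (-y) + 2.45 := by nlinarith
  have d3 : 0 < 1 + y := by linarith
  have d4 : 0 < 1 + -y := by linarith
  have d5 : 0 < (z + 2.45) ^ 2 - 9 * z := by nlinarith
  have d6 : 0 < 1 - z := by linarith
  have e1 : 1 / (1 + y) ^ 3 + 1 / (1 + -y) ^ 3 = 2 * (1 + 3 * z) / (1 - z) ^ 3 := by
    have : (1 - z) = (1 + y) * (1 + -y) := by rw [hz]; ring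
    rw [this, hz]
    field_simp
    ring
  have e2 : 1/2 * (1 / (y ^ 2 + 3 * y + 2.45)) + 1/2 * (1 / ((-y) ^ 2 + 3 * (-y) + 2.45)) = (z + 2.45) / ((z + 2.45) ^ 2 - 9 * z) := by
    have : (z + 2.45) ^ 2 - 9 * z = (y ^ 2 + 3 * y + 2.45) * ((-y) ^ 2 + 3 * (-y) + 2.45) := by rw [hz]; ring
    rw [this, hz, mul_one_div, mul_one_div, div_add_div _ _ d1.ne' d2.ne', div_eq_div_iff (by positivity) (by positivity)]
    ring
  have f1 : 2 * (1 + 3 * z) / (1 - z) ^ 3 ≤ 2.021 + 10.74 * z + 57.8 * z ^ 2 := by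
    rw [div_le_iff₀ (by positivity), ← sub_nonneg]
    have e : (2.021 + 10.74 * z + 57.8 * z ^ 2) * (1 - z) ^ 3 - 2 * (1 + 3 * z) =
      0.021 - 1.323 * z + 31.643 * z ^ 2 - 143.201 * z ^ 3 + 162.66 * z ^ 4 - 57.8 * z ^ 5 := by ring
    rw [e]
    rcases le_total z 0.07 with h | h
    · have g1 : 0 ≤ z ^ 2 * (0.07 - z) := mul_nonneg (by positivity) (by linarith)
      have g2 : 0 ≤ z ^ 4 * (0.07 - z) := mul_nonneg (by positivity) (by linarith)
      have g3 : 0 ≤ z ^ 4 := by positivity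
      nlinarith [sq_nonneg (0.145 - 4.565 * z)]
    · obtain ⟨w, hw⟩ : ∃ w, z = 0.07 + w := ⟨z - 0.07, by ring⟩
      have hw0 : 0 ≤ w := by linarith
      have hw1 : w ≤ 0.18 := by linarith
      rw [hw]
      have hq : 0 ≤ 0.18 - w := by linarith
      have : 0.021 - 1.323 * (0.07 + w) + 31.643 * (0.07 + w) ^ 2 - 143.201 * (0.07 + w) ^ 3 + 162.66 * (0.07 + w) ^ 4 - 57.8 * (0.07 + w) ^ 5 = 1906553957/9447840 * w^0 * (0.18 - w)^5 + 4099306631/1889568 * w^1 * (0.18 - w)^4 + 7289127185/944784 * w^2 * (0.18 - w)^3 + 8545773875/944784 * w^3 * (0.18 - w)^2 + 6434178125/1889568 * w^4 * (0.18 - w)^1 + 93671875/1889568 * w^5 * (0.18 - w)^0 := by ring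
      rw [this]
      positivity
  have f2 : (z + 2.45) / ((z + 2.45) ^ 2 - 9 * z) ≤ 0.409 + 0.46 * z + 0.2 * z ^ 2 := by
    rw [div_le_iff₀ d5]
    nlinarith [mul_nonneg hz0 (by linarith : 0 ≤ 1/4 - z), pow_nonneg hz0 3, pow_nonneg hz0 4,
      mul_nonneg (pow_nonneg hz0 2) (by linarith : 0 ≤ 1/4 - z)]
  have e4 : y ^ 4 = z ^ 2 := by rw [hz]; ring
  rw [e4, ← hz]
  rw [← hz] at e2
  have := sq_nonneg z
  linarith

end

section

lemma abs_cos_shift (k : ℕ) (y : ℝ) (h0 : -(1/2) ≤ y) (h1 : y ≤ 1/2) :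
    |cos (π * ((k:ℝ) + 1 + y))| = cos (π * y) := by
  have e : π * ((k:ℝ) + 1 + y) = π * y + ((k+1:ℕ):ℝ) * π := by push_cast; ring
  rw [e, cos_add_nat_mul_pi, abs_mul, abs_pow, abs_neg, abs_one, one_pow, one_mul]
  apply abs_of_nonneg
  apply cos_nonneg_of_neg_pi_div_two_le_of_le <;> nlinarith [pi_pos]

lemma bump (f : ℝ → ℝ) (hf : Continuous f) (k : ℕ) :
    ∫ x in (1 / (π ^ 2 * ((k:ℝ) + 3/2) ^ 2))..(1 / (π ^ 2 * ((k:ℝ) + 1/2) ^ 2)), f |cos (1 / √x)| =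
      ∫ y in (-(1/2) : ℝ)..(1/2), 2 / π ^ 2 * (f (cos (π * y)) * (1 / ((k:ℝ) + 1 + y) ^ 3)) := by
  have hk : (0:ℝ) ≤ k := Nat.cast_nonneg k
  have hpi := pi_pos
  have hu : Set.uIcc (-(1/2) : ℝ) (1/2) = Set.Icc (-(1/2)) (1/2) := Set.uIcc_of_le (by norm_num)
  have hder : ∀ y ∈ Set.uIcc (-(1/2) : ℝ) (1/2), HasDerivAt (fun y : ℝ => 1 / (π ^ 2 * ((k:ℝ) + 1 + y) ^ 2))
      (-(2 / π ^ 2 * (1 / ((k:ℝ) + 1 + y) ^ 3))) y := by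
    intro y hy
    rw [hu] at hy
    have hp : 0 < (k:ℝ) + 1 + y := by linarith [hy.1]
    have h1 := (((hasDerivAt_id' y).const_add ((k:ℝ) + 1)).pow 2).const_mul (π ^ 2)
    have h2 := h1.inv (by simp only [Pi.pow_apply]; positivity)
    have h4 : (fun y : ℝ => 1 / (π ^ 2 * ((k:ℝ) + 1 + y) ^ 2)) = (fun y => π ^ 2 * ((fun x => (k:ℝ) + 1 + x) ^ 2) y)⁻¹ := by
      funext y
      simp [one_div]
    rw [h4]
    refine h2.congr_deriv ?_
    simp only [Pi.pow_apply]
    norm_num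
    field_simp
  have h := intervalIntegral.integral_comp_mul_deriv' (a := -(1/2)) (b := 1/2) (f := fun y : ℝ => 1 / (π ^ 2 * ((k:ℝ) + 1 + y) ^ 2))
    (f' := fun y => -(2 / π ^ 2 * (1 / ((k:ℝ) + 1 + y) ^ 3))) (g := fun x => f |cos (1 / √x)|) hder ?_ ?_
  · rw [intervalIntegral.integral_symm]
    rw [show (k:ℝ) + 1 + -(1/2) = k + 1/2 by ring, show (k:ℝ) + 1 + 1/2 = k + 3/2 by ring] at h
    rw [← h, ← intervalIntegral.integral_neg]
    apply intervalIntegral.integral_congr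
    intro y hy
    rw [hu] at hy
    have hp : 0 < (k:ℝ) + 1 + y := by linarith [hy.1]
    simp only [Function.comp_apply]
    have e1 : 1 / √(1 / (π ^ 2 * ((k:ℝ) + 1 + y) ^ 2)) = π * ((k:ℝ) + 1 + y) := by
      rw [← mul_pow, sqrt_div (by norm_num), sqrt_one, sqrt_sq (by positivity), one_div_one_div]
    rw [e1, abs_cos_shift k y hy.1 hy.2]
    ring
  · intro y hy
    rw [hu] at hy
    have hp : 0 < (k:ℝ) + 1 + y := by linarith [hy.1]
    apply ContinuousAt.continuousWithinAt
    fun_prop (disch := positivity)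
  · intro x hx
    obtain ⟨y, hy, rfl⟩ := hx
    rw [hu] at hy
    have hp : 0 < (k:ℝ) + 1 + y := by linarith [hy.1]
    apply ContinuousAt.continuousWithinAt
    have : √(1 / (π ^ 2 * ((k:ℝ) + 1 + y) ^ 2)) ≠ 0 := by positivity
    have h2 : ContinuousAt (fun x => 1 / √x) (1 / (π ^ 2 * ((k:ℝ) + 1 + y) ^ 2)) :=
      continuousAt_const.div (by fun_prop) this
    exact hf.continuousAt.comp (continuous_abs.continuousAt.comp (continuous_cos.continuousAt.comp h2))

open MeasureTheory in
lemma bump_int (f : ℝ → ℝ) (hf : Continuous f) (hf1 : ∀ y ∈ Set.Icc (0:ℝ) 1, 0 ≤ f y ∧ f y ≤ 1) (a b : ℝ) :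
    IntervalIntegrable (fun x => f |cos (1 / √x)|) volume a b := by
  rw [intervalIntegrable_iff]
  refine Measure.integrableOn_of_bounded (M := 1) (by simp) (by
    apply Measurable.aestronglyMeasurable
    have := hf.measurable
    fun_prop) ?_
  filter_upwards with x
  have := hf1 |cos (1 / √x)| ⟨abs_nonneg _, abs_cos_le_one _⟩
  rw [Real.norm_of_nonneg this.1]; exact this.2

open MeasureTheory in
lemma osc_bound (f : ℝ → ℝ) (hf : Continuous f) (hf1 : ∀ y ∈ Set.Icc (0:ℝ) 1, 0 ≤ f y ∧ f y ≤ 1) :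
    ∫ x in (0:ℝ)..(4 / π ^ 2), f |cos (1 / √x)| ≤
      ∫ y in (0:ℝ)..(1/2), 2 / π ^ 2 * (f (cos (π * y)) * (2.43 + 11.2 * y ^ 2 + 58 * y ^ 4)) := by
  have hpi := pi_pos
  set X : ℕ → ℝ := fun k => 1 / (π ^ 2 * ((k:ℝ) + 1/2) ^ 2) with hX
  have hX0 : X 0 = 4 / π ^ 2 := by simp only [hX]; norm_num; ring
  have hcos : ∀ y ∈ Set.Icc (-(1/2):ℝ) (1/2), 0 ≤ f (cos (π * y)) := by
    intro y hy
    apply (hf1 _ ⟨_, cos_le_one _⟩).1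
    apply cos_nonneg_of_neg_pi_div_two_le_of_le <;> nlinarith [hy.1, hy.2]
  have hcontk : ∀ k : ℕ, IntervalIntegrable (fun y => 2 / π ^ 2 * (f (cos (π * y)) * (1 / ((k:ℝ) + 1 + y) ^ 3))) volume (-(1/2)) (1/2) := by
    intro k
    apply ContinuousOn.intervalIntegrable
    rw [Set.uIcc_of_le (by norm_num)]
    intro y hy
    have hp : 0 < (k:ℝ) + 1 + y := by have : (0:ℝ) ≤ k := Nat.cast_nonneg k
                                      linarith [hy.1]
    apply ContinuousAt.continuousWithinAt
    fun_prop (disch := positivity)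
  have hconth : ∀ y ∈ Set.Icc (-(1/2):ℝ) (1/2), ContinuousAt hker y := by
    intro y hy
    unfold hker
    have d1 : 0 < 1 + y := by linarith [hy.1]
    have d2 : 0 < y ^ 2 + 3 * y + 2.45 := by nlinarith [hy.1]
    fun_prop (disch := positivity)
  have hker_ii : IntervalIntegrable (fun y => 2 / π ^ 2 * (f (cos (π * y)) * hker y)) volume (-(1/2)) (1/2) := by
    apply ContinuousOn.intervalIntegrable
    rw [Set.uIcc_of_le (by norm_num)]
    intro y hy
    apply ContinuousAt.continuousWithinAt
    have := hconth y hy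
    fun_prop
  -- partial sums
  have hpart : ∀ N : ℕ, ∫ x in (X N)..(4 / π ^ 2), f |cos (1 / √x)| =
      ∑ k ∈ Finset.range N, ∫ y in (-(1/2) : ℝ)..(1/2), 2 / π ^ 2 * (f (cos (π * y)) * (1 / ((k:ℝ) + 1 + y) ^ 3)) := by
    intro N
    induction N with
    | zero => rw [hX0]; simp
    | succ n ih =>
      rw [Finset.sum_range_succ, ← ih, ← bump f hf n, add_comm (∫ x in (X n).._, _)]
      have e : X (n+1) = 1 / (π ^ 2 * ((n:ℝ) + 3/2) ^ 2) := by simp only [hX]; push_cast; ring_nf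
      rw [e]
      exact (intervalIntegral.integral_add_adjacent_intervals (bump_int f hf hf1 _ _) (bump_int f hf hf1 _ _)).symm
  have hbd : ∀ N : ℕ, ∫ x in (X (N+1))..(4 / π ^ 2), f |cos (1 / √x)| ≤
      ∫ y in (-(1/2) : ℝ)..(1/2), 2 / π ^ 2 * (f (cos (π * y)) * hker y) := by
    intro N
    rw [hpart, ← intervalIntegral.integral_finsetSum (fun k _ => hcontk k)]
    apply intervalIntegral.integral_mono_on (by norm_num) _ hker_ii
    · intro y hy
      rw [← Finset.mul_sum, ← Finset.mul_sum]
      have := hcos y hy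
      gcongr
      rw [Finset.sum_range_succ']
      have h := kernel_sum y hy.1 N
      unfold hker
      push_cast
      rw [zero_add, add_comm]
      have e : ∀ k : ℕ, (k:ℝ) + 1 + 1 + y = k + 2 + y := fun k => by ring
      simp only [e]
      linarith
    · have := IntervalIntegrable.sum (Finset.range (N+1)) (fun k _ => hcontk k)
      simpa only [Finset.sum_fn] using this
  have hsym : ∫ y in (-(1/2) : ℝ)..(1/2), 2 / π ^ 2 * (f (cos (π * y)) * hker y) ≤
      ∫ y in (0:ℝ)..(1/2), 2 / π ^ 2 * (f (cos (π * y)) * (2.43 + 11.2 * y ^ 2 + 58 * y ^ 4)) := by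
    have s1 : Set.uIcc (-(1/2):ℝ) 0 ⊆ Set.uIcc (-(1/2)) (1/2) := by
      rw [Set.uIcc_of_le (by norm_num), Set.uIcc_of_le (by norm_num)]
      exact Set.Icc_subset_Icc le_rfl (by norm_num)
    have s2 : Set.uIcc (0:ℝ) (1/2) ⊆ Set.uIcc (-(1/2)) (1/2) := by
      rw [Set.uIcc_of_le (by norm_num), Set.uIcc_of_le (by norm_num)]
      exact Set.Icc_subset_Icc (by norm_num) le_rfl
    have i1 := hker_ii.mono_set s1
    have i2 := hker_ii.mono_set s2
    have i3 : IntervalIntegrable (fun y => 2 / π ^ 2 * (f (cos (π * y)) * hker (-y))) volume 0 (1/2) := by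
      have := (IntervalIntegrable.iff_comp_neg).1 i1
      rw [neg_zero, neg_neg] at this
      simpa using this.symm
    rw [← intervalIntegral.integral_add_adjacent_intervals i1 i2]
    have e : ∫ y in (-(1/2):ℝ)..0, 2 / π ^ 2 * (f (cos (π * y)) * hker y) =
        ∫ y in (0:ℝ)..(1/2), 2 / π ^ 2 * (f (cos (π * y)) * hker (-y)) := by
      have := intervalIntegral.integral_comp_neg (a := 0) (b := 1/2) (fun y => 2 / π ^ 2 * (f (cos (π * y)) * hker y))
      rw [neg_zero] at this
      rw [← this]
      simp
    rw [e, ← intervalIntegral.integral_add i3 i2]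
    apply intervalIntegral.integral_mono_on (by norm_num) (i3.add i2)
    · apply Continuous.intervalIntegrable; fun_prop
    · intro y hy
      have h1 := hker_sym y hy.1 hy.2
      have h2 := hcos y ⟨by linarith [hy.1], hy.2⟩
      rw [← mul_add, ← mul_add, add_comm]
      gcongr
  have hXpos : ∀ N, 0 < X N := fun N => by simp only [hX]; positivity
  have hfin : ∀ N : ℕ, ∫ x in (0:ℝ)..(4 / π ^ 2), f |cos (1 / √x)| ≤
      (∫ y in (0:ℝ)..(1/2), 2 / π ^ 2 * (f (cos (π * y)) * (2.43 + 11.2 * y ^ 2 + 58 * y ^ 4))) + X (N+1) := by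
    intro N
    rw [← intervalIntegral.integral_add_adjacent_intervals (b := X (N+1)) (bump_int f hf hf1 _ _) (bump_int f hf hf1 _ _), add_comm]
    have h1 : ∫ x in (0:ℝ)..X (N+1), f |cos (1 / √x)| ≤ ∫ x in (0:ℝ)..X (N+1), (1:ℝ) := by
      apply intervalIntegral.integral_mono_on (hXpos _).le (bump_int f hf hf1 _ _) (by simp)
      intro x _
      exact (hf1 |cos (1 / √x)| ⟨abs_nonneg _, abs_cos_le_one _⟩).2
    simp only [intervalIntegral.integral_const, sub_zero, smul_eq_mul, mul_one] at h1
    have := (hbd N).trans hsym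
    linarith
  have hlim : Filter.Tendsto (fun N : ℕ => X (N+1)) Filter.atTop (nhds 0) := by
    refine squeeze_zero (fun N => (hXpos _).le) (fun N => ?_) tendsto_one_div_add_atTop_nhds_zero_nat
    simp only [hX]
    push_cast
    apply one_div_le_one_div_of_le (by positivity)
    have hN : (0:ℝ) ≤ N := Nat.cast_nonneg N
    have := lt_pi_sq
    nlinarith [sq_nonneg ((N:ℝ) + 1 + 1/2)]
  have hl2 := hlim.const_add (∫ y in (0:ℝ)..(1/2), 2 / π ^ 2 * (f (cos (π * y)) * (2.43 + 11.2 * y ^ 2 + 58 * y ^ 4)))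
  rw [add_zero] at hl2
  exact ge_of_tendsto' hl2 hfin

end

section

lemma int_cos_poly (A B C c : ℝ) (hc : c ≠ 0) (b : ℝ) :
    ∫ y in (0:ℝ)..b, cos (c * y) * (A + B * y ^ 2 + C * y ^ 4) =
      (A + B * b ^ 2 + C * b ^ 4) * sin (c * b) / c + (2 * B * b + 4 * C * b ^ 3) * cos (c * b) / c ^ 2
      - (2 * B + 12 * C * b ^ 2) * sin (c * b) / c ^ 3 - 24 * C * b * cos (c * b) / c ^ 4 + 24 * C * sin (c * b) / c ^ 5 := by
  have hd : ∀ y : ℝ, HasDerivAt (fun y : ℝ => (A + B * y ^ 2 + C * y ^ 4) * sin (c * y) / c + (2 * B * y + 4 * C * y ^ 3) * cos (c * y) / c ^ 2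
      - (2 * B + 12 * C * y ^ 2) * sin (c * y) / c ^ 3 - 24 * C * y * cos (c * y) / c ^ 4 + 24 * C * sin (c * y) / c ^ 5)
      (cos (c * y) * (A + B * y ^ 2 + C * y ^ 4)) y := by
    intro y
    have hid : HasDerivAt (fun y : ℝ => c * y) c y := by simpa using (hasDerivAt_id' y).const_mul c
    have hs := hid.sin
    have hco := hid.cos
    have p2 := hasDerivAt_pow 2 y
    have p3 := hasDerivAt_pow 3 y
    have p4 := hasDerivAt_pow 4 y
    have t1 := ((((p2.const_mul B).const_add A).add (p4.const_mul C)).mul hs).div_const c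
    have t2 := ((((hasDerivAt_id' y).const_mul (2 * B)).add (p3.const_mul (4 * C))).mul hco).div_const (c ^ 2)
    have t3 := (((p2.const_mul (12 * C)).const_add (2 * B)).mul hs).div_const (c ^ 3)
    have t4 := (((hasDerivAt_id' y).const_mul (24 * C)).mul hco).div_const (c ^ 4)
    have t5 := (hs.const_mul (24 * C)).div_const (c ^ 5)
    refine ((((t1.add t2).sub t3).sub t4).add t5).congr_deriv ?_
    simp only [Pi.add_apply]
    field_simp
    norm_num
    ring
  rw [intervalIntegral.integral_eq_sub_of_hasDerivAt (fun y _ => hd y) (by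
    apply Continuous.intervalIntegrable; fun_prop)]
  simp

lemma inv_pi_bounds : 0.318309 ≤ π⁻¹ ∧ π⁻¹ ≤ 0.318310 := by
  have h1 := Real.pi_gt_d6
  have h2 := Real.pi_lt_d6
  constructor
  · rw [le_inv_comm₀ (by norm_num) pi_pos]; refine h2.le.trans (by norm_num)
  · rw [inv_le_comm₀ pi_pos (by norm_num)]; refine le_trans (by norm_num) h1.le

lemma b1_bound : ∫ x in (0:ℝ)..(4 / π ^ 2), |cos (1 / √x)| ≤ 0.2096 := by
  refine (osc_bound (fun y => y) continuous_id (fun y hy => hy)).trans ?_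
  rw [intervalIntegral.integral_const_mul, int_cos_poly _ _ _ π pi_ne_zero, mul_one_div, sin_pi_div_two, cos_pi_div_two]
  obtain ⟨h1, h2⟩ := inv_pi_bounds
  set r := π⁻¹ with hr
  have e : 2 / π ^ 2 * ((2.43 + 11.2 * (1/2:ℝ) ^ 2 + 58 * (1/2) ^ 4) * 1 / π + (2 * 11.2 * (1/2) + 4 * 58 * (1/2) ^ 3) * 0 / π ^ 2
      - (2 * 11.2 + 12 * 58 * (1/2) ^ 2) * 1 / π ^ 3 - 24 * 58 * (1/2) * 0 / π ^ 4 + 24 * 58 * 1 / π ^ 5) =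
      17.71 * r ^ 3 - 392.8 * r ^ 5 + 2784 * r ^ 7 := by
    rw [hr]; field_simp; ring
  rw [e]
  have p3 : r ^ 3 ≤ 0.318310 ^ 3 := by gcongr
  have p5 : 0.318309 ^ 5 ≤ r ^ 5 := by gcongr
  have p7 : r ^ 7 ≤ 0.318310 ^ 7 := by gcongr
  norm_num at p3 p5 p7 ⊢
  linarith

lemma b2_bound : ∫ x in (0:ℝ)..(4 / π ^ 2), |cos (1 / √x)| ^ 2 ≤ 0.1494 := by
  refine (osc_bound (fun y => y ^ 2) (by fun_prop) (fun y hy => ⟨by positivity, by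
    have := hy.1; have := hy.2; nlinarith⟩)).trans ?_
  have e0 : ∀ y : ℝ, 2 / π ^ 2 * (cos (π * y) ^ 2 * (2.43 + 11.2 * y ^ 2 + 58 * y ^ 4)) =
     1 / π ^ 2 * ((2.43 + 11.2 * y ^ 2 + 58 * y ^ 4) + cos (2 * π * y) * (2.43 + 11.2 * y ^ 2 + 58 * y ^ 4)) := by
    intro y
    rw [show 2 * π * y = 2 * (π * y) by ring, cos_two_mul]; ring
  simp only [e0]
  rw [intervalIntegral.integral_const_mul, intervalIntegral.integral_add (by
    apply Continuous.intervalIntegrable; fun_prop) (by apply Continuous.intervalIntegrable; fun_prop),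
    int_cos_poly _ _ _ (2 * π) (by positivity), show 2 * π * (1/2) = π by ring, sin_pi, cos_pi]
  have e1 : ∫ y in (0:ℝ)..(1/2), (2.43 + 11.2 * y ^ 2 + 58 * y ^ 4) = 2.43 / 2 + 11.2 / 24 + 58 / 160 := by
    rw [intervalIntegral.integral_add (by apply Continuous.intervalIntegrable; fun_prop)
      (by apply Continuous.intervalIntegrable; fun_prop), intervalIntegral.integral_add (by apply Continuous.intervalIntegrable; fun_prop)
      (by apply Continuous.intervalIntegrable; fun_prop), intervalIntegral.integral_const_mul, intervalIntegral.integral_const_mul,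
      integral_pow, integral_pow]
    simp
    norm_num
  rw [e1]
  obtain ⟨h1, h2⟩ := inv_pi_bounds
  set r := π⁻¹ with hr
  have e : 1 / π ^ 2 * (2.43 / 2 + 11.2 / 24 + 58 / 160 + ((2.43 + 11.2 * (1/2:ℝ) ^ 2 + 58 * (1/2) ^ 4) * 0 / (2 * π)
     + (2 * 11.2 * (1/2) + 4 * 58 * (1/2) ^ 3) * -1 / (2 * π) ^ 2
      - (2 * 11.2 + 12 * 58 * (1/2) ^ 2) * 0 / (2 * π) ^ 3 - 24 * 58 * (1/2) * -1 / (2 * π) ^ 4 + 24 * 58 * 0 / (2 * π) ^ 5)) =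
      (2.43 / 2 + 11.2 / 24 + 58 / 160) * r ^ 2 - 10.05 * r ^ 4 + 43.5 * r ^ 6 := by
    rw [hr]; field_simp; ring
  rw [e]
  have p3 : r ^ 2 ≤ 0.318310 ^ 2 := by gcongr
  have p5 : 0.318309 ^ 4 ≤ r ^ 4 := by gcongr
  have p7 : r ^ 6 ≤ 0.318310 ^ 6 := by gcongr
  norm_num at p3 p5 p7 ⊢
  linarith

end

section
open MeasureTheory

lemma xc_exists : ∃ xc : ℝ, 1 / π ^ 2 ≤ xc ∧ xc ≤ 4 / π ^ 2 ∧
    (∀ x, 1 / π ^ 2 ≤ x → x ≤ xc → exp (-(1 / (2 * x))) ≤ |cos (1 / √x)|) ∧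
    (∀ x, xc ≤ x → x ≤ 4 / π ^ 2 → |cos (1 / √x)| ≤ exp (-(1 / (2 * x)))) := by
  have hpi := pi_pos
  have hpi3 := pi_gt_three
  let g : ℝ → ℝ := fun u => exp (-(u ^ 2 / 2)) + cos u
  have hg : Continuous g := by simp only [g]; fun_prop
  have hanti : AntitoneOn g (Set.Icc (π / 2) π) := by
    intro u hu v hv huv
    simp only [g]
    have h1 : exp (-(v ^ 2 / 2)) ≤ exp (-(u ^ 2 / 2)) := by
      apply exp_le_exp.2
      have : u ^ 2 ≤ v ^ 2 := pow_le_pow_left₀ (by linarith [hu.1]) huv 2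
      linarith
    have h2 : cos v ≤ cos u := cos_le_cos_of_nonneg_of_le_pi (by linarith [hu.1]) hv.2 huv
    linarith
  have hends : (0:ℝ) ∈ Set.Icc (g π) (g (π / 2)) := by
    constructor
    · simp only [g, cos_pi]
      have : exp (-(π ^ 2 / 2)) ≤ 1 := exp_le_one_iff.2 (by have := sq_nonneg π; linarith)
      linarith
    · simp only [g, cos_pi_div_two]
      positivity
  obtain ⟨uc, huc, hguc⟩ := intermediate_value_Icc' (by linarith : π / 2 ≤ π) hg.continuousOn hends
  have hucpos : 0 < uc := by linarith [huc.1]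
  have key : ∀ x : ℝ, 0 < x → (1 / √x) ^ 2 = 1 / x := by
    intro x hx
    rw [div_pow, Real.sq_sqrt hx.le, one_pow]
  have habs : ∀ u ∈ Set.Icc (π / 2) π, |cos u| = - cos u := by
    intro u hu
    exact abs_of_nonpos (cos_nonpos_of_pi_div_two_le_of_le hu.1 (by linarith [hu.2]))
  have hle : ∀ a b : ℝ, 0 ≤ a → 0 ≤ b → a ^ 2 ≤ b ^ 2 → a ≤ b := fun a b _ hb h => le_of_sq_le_sq h hb
  refine ⟨1 / uc ^ 2, ?_, ?_, ?_, ?_⟩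
  · exact one_div_le_one_div_of_le (by positivity) (pow_le_pow_left₀ hucpos.le huc.2 2)
  · rw [div_le_div_iff₀ (by positivity) (by positivity)]
    nlinarith [huc.1]
  · intro x hx1 hx2
    have hx : 0 < x := lt_of_lt_of_le (by positivity) hx1
    have k := key x hx
    have hu0 : 0 ≤ 1 / √x := by positivity
    have a1 : uc ≤ 1 / √x := by
      apply hle _ _ hucpos.le hu0
      rw [k, le_div_iff₀ hx]
      rw [le_div_iff₀ (by positivity)] at hx2
      linarith
    have a2 : 1 / √x ≤ π := by
      apply hle _ _ hu0 hpi.le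
      rw [k, div_le_iff₀ hx]
      rw [div_le_iff₀ (by positivity)] at hx1
      linarith
    have hm : 1 / √x ∈ Set.Icc (π / 2) π := ⟨huc.1.trans a1, a2⟩
    have := hanti huc hm a1
    rw [hguc] at this
    simp only [g, k] at this
    rw [habs _ hm]
    have e : 1 / (2 * x) = 1 / x / 2 := by field_simp
    rw [e]; linarith
  · intro x hx1 hx2
    have hx : 0 < x := lt_of_lt_of_le (by positivity) hx1
    have k := key x hx
    have hu0 : 0 ≤ 1 / √x := by positivity
    have a1 : 1 / √x ≤ uc := by
      apply hle _ _ hu0 hucpos.le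
      rw [k, div_le_iff₀ hx]
      rw [div_le_iff₀ (by positivity)] at hx1
      linarith
    have a2 : π / 2 ≤ 1 / √x := by
      apply hle _ _ (by positivity) hu0
      rw [k, le_div_iff₀ hx]
      rw [le_div_iff₀ (by positivity)] at hx2
      nlinarith
    have hm : 1 / √x ∈ Set.Icc (π / 2) π := ⟨a2, a1.trans huc.2⟩
    have := hanti hm huc a1
    rw [hguc] at this
    simp only [g, k] at this
    rw [habs _ hm]
    have e : 1 / (2 * x) = 1 / x / 2 := by field_simp
    rw [e]; linarith

noncomputable def Gf (s x : ℝ) : ℝ := if 0 < x then exp (-(s / (2 * x))) else 0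

lemma Gf_mono (s : ℝ) (hs : 0 < s) : Monotone (Gf s) := by
  intro x y hxy
  unfold Gf
  split_ifs with h1 h2 h2
  · apply exp_le_exp.2
    apply neg_le_neg
    gcongr
  · linarith
  · positivity
  · exact le_rfl

lemma Gf_ii (s : ℝ) (hs : 0 < s) (a b : ℝ) : IntervalIntegrable (Gf s) volume a b :=
  (Gf_mono s hs).intervalIntegrable

lemma Gf_int_le (s : ℝ) (hs : 0 < s) (a b : ℝ) (hab : a ≤ b) : ∫ x in a..b, Gf s x ≤ (b - a) * Gf s b := by
  have : ∫ x in a..b, Gf s x ≤ ∫ x in a..b, Gf s b :=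
    intervalIntegral.integral_mono_on hab (Gf_ii s hs _ _) (by simp) fun x hx => Gf_mono s hs hx.2
  simpa using this

lemma le_Gf_int (s : ℝ) (hs : 0 < s) (a b : ℝ) (hab : a ≤ b) : (b - a) * Gf s a ≤ ∫ x in a..b, Gf s x := by
  have : ∫ x in a..b, Gf s a ≤ ∫ x in a..b, Gf s x :=
    intervalIntegral.integral_mono_on hab (by simp) (Gf_ii s hs _ _) fun x hx => Gf_mono s hs hx.1
  simpa using this

lemma gm_two : gm 2 = 1 := by
  have := gm_eq 0
  simp only [mul_zero, add_zero, rpow_zero, one_mul] at this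
  rw [this, div_self (Gamma_pos_of_pos (by norm_num)).ne']

lemma cosS_int (s : ℝ) (hs : 0 < s) (a b : ℝ) : IntervalIntegrable (fun x => |cos (1 / √x)| ^ s) volume a b := by
  have := bump_int (fun y => |y| ^ s) (by
    exact Continuous.rpow_const (by fun_prop) (fun x => Or.inr hs.le)) (fun y hy => ?_) a b
  · simpa using this
  · simp only [abs_of_nonneg hy.1]
    exact ⟨rpow_nonneg hy.1 _, rpow_le_one hy.1 hy.2 hs.le⟩

lemma bs_two (s : ℝ) (hs : 2 ≤ s) : ∫ x in (0:ℝ)..(4 / π ^ 2), |cos (1 / √x)| ^ s ≤ 0.1494 := by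
  refine le_trans ?_ b2_bound
  apply intervalIntegral.integral_mono_on (by positivity) (cosS_int s (by linarith) _ _)
  · simpa using cosS_int 2 (by norm_num) 0 (4 / π ^ 2)
  · intro x _
    rw [← rpow_natCast]
    exact rpow_le_rpow_of_exponent_ge' (abs_nonneg _) (abs_cos_le_one _) (by norm_num) (by simpa using hs)

lemma bs_gen (s : ℝ) (hs : 5/3 ≤ s) : ∫ x in (0:ℝ)..(4 / π ^ 2), |cos (1 / √x)| ^ s ≤ 0.1674 := by
  have i1 : IntervalIntegrable (fun x => |cos (1 / √x)|) volume 0 (4 / π ^ 2) := by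
    simpa using cosS_int 1 (by norm_num) 0 (4 / π ^ 2)
  have i2 : IntervalIntegrable (fun x => |cos (1 / √x)| ^ 2) volume 0 (4 / π ^ 2) := by
    simpa using cosS_int 2 (by norm_num) 0 (4 / π ^ 2)
  have : ∫ x in (0:ℝ)..(4 / π ^ 2), |cos (1 / √x)| ^ s ≤
      ∫ x in (0:ℝ)..(4 / π ^ 2), (0.27 * |cos (1 / √x)| + 0.7408 * |cos (1 / √x)| ^ 2) := by
    apply intervalIntegral.integral_mono_on (by positivity) (cosS_int s (by linarith) _ _)
      ((i1.const_mul _).add (i2.const_mul _))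
    intro x _
    set y := |cos (1 / √x)|
    have hy : 0 ≤ y := abs_nonneg _
    have h1 : y ^ s ≤ y ^ (5/3 : ℝ) :=
      rpow_le_rpow_of_exponent_ge' hy (abs_cos_le_one _) (by norm_num) hs
    refine h1.trans ?_
    have h2 := Real.geom_mean_le_arith_mean2_weighted (w₁ := 1/3) (w₂ := 2/3) (p₁ := 0.81 * y) (p₂ := y ^ 2 / 0.9)
      (by norm_num) (by norm_num) (by positivity) (by positivity) (by norm_num)
    have h3 : (0.81 * y) ^ (1/3:ℝ) * (y ^ 2 / 0.9) ^ (2/3:ℝ) = y ^ (5/3:ℝ) := by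
      rw [mul_rpow (by norm_num) hy, div_rpow (by positivity) (by norm_num), ← rpow_natCast y 2, ← rpow_mul hy]
      have e1 : (0.81:ℝ) ^ (1/3:ℝ) = 0.9 ^ (2/3:ℝ) := by
        rw [show (0.81:ℝ) = 0.9 ^ (2:ℝ) by norm_num, ← rpow_mul (by norm_num)]; norm_num
      rw [e1]
      have e2 : (0.9:ℝ) ^ (2/3:ℝ) ≠ 0 := by positivity
      have e3 : y ^ (5/3:ℝ) = y ^ (1/3:ℝ) * y ^ ((2:ℕ) * (2/3):ℝ) := by
        rw [← rpow_add_of_nonneg hy (by norm_num) (by norm_num)]; norm_num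
      rw [e3]; field_simp
    rw [h3] at h2
    have e4 : y ^ 2 / 0.9 = 10 / 9 * y ^ 2 := by norm_num; ring
    rw [e4] at h2
    nlinarith [sq_nonneg y]
  rw [intervalIntegral.integral_add (i1.const_mul _) (i2.const_mul _), intervalIntegral.integral_const_mul,
    intervalIntegral.integral_const_mul] at this
  have := b1_bound
  have := b2_bound
  linarith

end

section
open MeasureTheory

lemma cos_rpow_le_Gf (s x c : ℝ) (hs : 0 < s) (hx : 4 / π ^ 2 ≤ x) (hc : c ≤ 1/6 + 1/(60 * x)) (hcx : c < x) :
    |cos (1 / √x)| ^ s ≤ Gf s (x - c) := by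
  have hpi := pi_pos
  have hx0 : 0 < x := lt_of_lt_of_le (by positivity) hx
  have hu : 1 / √x ≤ π / 2 := by
    apply le_of_sq_le_sq _ (by positivity)
    rw [div_pow, Real.sq_sqrt hx0.le, one_pow, div_le_iff₀ hx0]
    rw [div_le_iff₀ (by positivity)] at hx
    nlinarith
  have hu0 : 0 ≤ 1 / √x := by positivity
  have hcos : 0 ≤ cos (1 / √x) := cos_nonneg_of_neg_pi_div_two_le_of_le (by linarith) hu
  rw [abs_of_nonneg hcos, Gf, if_pos (by linarith)]
  refine (rpow_le_rpow hcos (cos_le_G x c hx hc hcx) hs.le).trans_eq ?_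
  rw [← exp_mul]
  congr 1
  have : x - c ≠ 0 := by linarith
  field_simp

lemma four_div_pi_sq : 0.4 < 4 / π ^ 2 ∧ 4 / π ^ 2 < 0.41 ∧ 1 / π ^ 2 < 0.18 := by
  have h1 := pi_sq_lt
  have h2 := lt_pi_sq
  have : 0 < π ^ 2 := by positivity
  refine ⟨?_, ?_, ?_⟩
  · rw [lt_div_iff₀ this]; linarith
  · rw [div_lt_iff₀ this]; linarith
  · rw [div_lt_iff₀ this]; linarith

lemma num_bound (s : ℝ) (hs : 5/3 ≤ s) : ∫ x in (0:ℝ)..(4 / π ^ 2), |cos (1 / √x)| ^ s ≤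
    (1/75) * Gf s 1.07 + (1/6) * exp (-(1/1000)) - 0.18 * Gf s 0.18 := by
  have he : (0.999:ℝ) ≤ exp (-(1/1000)) := by
    have := add_one_le_exp (-(1/1000) : ℝ)
    linarith
  have e1 := exp_one_gt_d9
  have e2 := exp_one_lt_d9
  have hG : Gf s 0.18 ≤ 0.0184 := by
    rw [Gf, if_pos (by norm_num)]
    have : exp (-(s / (2 * 0.18))) ≤ exp (-(4:ℕ) * 1) := by
      apply exp_le_exp.2
      norm_num
      linarith
    refine this.trans ?_
    rw [neg_mul, exp_neg, exp_nat_mul]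
    rw [inv_le_comm₀ (by positivity) (by norm_num)]
    calc (0.0184:ℝ)⁻¹ ≤ 2.718 ^ 4 := by norm_num
      _ ≤ _ := by gcongr; linarith
  have hG0 : 0 ≤ Gf s 1.07 := by
    rw [Gf, if_pos (by norm_num)]; positivity
  rcases le_total 2 s with h | h
  · have := bs_two s h
    linarith
  · have := bs_gen s hs
    have : 0.3678 ≤ Gf s 1.07 := by
      rw [Gf, if_pos (by norm_num)]
      have h1 : exp (-1) ≤ exp (-(s / (2 * 1.07))) := by
        apply exp_le_exp.2
        norm_num
        linarith
      refine le_trans ?_ h1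
      rw [exp_neg, le_inv_comm₀ (by norm_num) (by positivity)]
      refine e2.le.trans (by norm_num)
    linarith

lemma lemma_H (δ : ℝ) (h0 : 0 < δ) (s : ℝ) (hs : 5/3 ≤ s) :
    ∃ M : ℝ → ℝ, IntegrableOn M (Set.Ioi 0) ∧ 0 ≤ ∫ x in Set.Ioi (0:ℝ), M x ∧
      ∀ x, 0 < x → M x ≤ (exp (-(s / (2 * x))) - |cos (1 / √x)| ^ s) * x ^ δ := by
  obtain ⟨xc, hc1, hc2, hc3, hc4⟩ := xc_exists
  obtain ⟨p1, p2, p3⟩ := four_div_pi_sq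
  have hpi := pi_pos
  have hs0 : 0 < s := by linarith
  have hxc : 0 < xc := lt_of_lt_of_le (by positivity) hc1
  obtain ⟨X, hX⟩ : ∃ X : ℝ, X = 1/6 + 500 * s := ⟨_, rfl⟩
  let C : ℝ → ℝ := fun x => -|cos (1 / √x)| ^ s
  let D1 : ℝ → ℝ := fun x => Gf s x - Gf s (x - 0.18)
  let D2 : ℝ → ℝ := fun x => Gf s x - Gf s (x - 1/6)
  have iC : ∀ a b, IntervalIntegrable C volume a b := fun a b => (cosS_int s hs0 a b).neg
  have isub : ∀ c a b, IntervalIntegrable (fun x => Gf s (x - c)) volume a b := fun c a b =>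
    Monotone.intervalIntegrable fun x y hxy => Gf_mono s hs0 (by linarith)
  have iD1 : ∀ a b, IntervalIntegrable D1 volume a b := fun a b => (Gf_ii s hs0 a b).sub (isub _ a b)
  have iD2 : ∀ a b, IntervalIntegrable D2 volume a b := fun a b => (Gf_ii s hs0 a b).sub (isub _ a b)
  have tool : ∀ (f : ℝ → ℝ) (a b : ℝ), 0 ≤ a → a ≤ b → IntervalIntegrable f volume a b →
      IntegrableOn ((Set.Ioc a b).indicator f) (Set.Ioi 0) ∧
      ∫ x in Set.Ioi (0:ℝ), (Set.Ioc a b).indicator f x = ∫ x in a..b, f x := by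
    intro f a b ha hab hf
    constructor
    · apply Integrable.integrableOn
      rw [integrable_indicator_iff measurableSet_Ioc]
      exact (intervalIntegrable_iff_integrableOn_Ioc_of_le hab).1 hf
    · rw [setIntegral_indicator measurableSet_Ioc, intervalIntegral.integral_of_le hab]
      congr 2
      ext x
      simp only [Set.mem_inter_iff, Set.mem_Ioi, Set.mem_Ioc]
      constructor
      · exact fun h => h.2
      · exact fun h => ⟨by linarith [h.1], h⟩
  obtain ⟨tC, tC'⟩ := tool C 0 (4 / π ^ 2) le_rfl (by positivity) (iC _ _)
  obtain ⟨t1, t1'⟩ := tool D1 0.18 1.25 (by norm_num) (by norm_num) (iD1 _ _)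
  obtain ⟨t2, t2'⟩ := tool D2 1.25 X (by norm_num) (by linarith) (iD2 _ _)
  let m0 : ℝ → ℝ := fun x => (Set.Ioc 0 (4 / π ^ 2)).indicator C x + (Set.Ioc 0.18 1.25).indicator D1 x
    + (Set.Ioc 1.25 X).indicator D2 x
  refine ⟨fun x => xc ^ δ * m0 x, ((tC.add t1).add t2).const_mul _, ?_, ?_⟩
  · rw [integral_const_mul]
    refine mul_nonneg (by positivity) ?_
    simp only [m0]
    have tCt1 : IntegrableOn (fun x => (Set.Ioc 0 (4 / π ^ 2)).indicator C x + (Set.Ioc 0.18 1.25).indicator D1 x)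
        (Set.Ioi 0) := tC.add t1
    rw [integral_add tCt1 t2, integral_add tC t1, tC', t1', t2']
    simp only [C, D1, D2]
    rw [intervalIntegral.integral_neg, intervalIntegral.integral_sub (Gf_ii s hs0 _ _) (isub _ _ _),
      intervalIntegral.integral_sub (Gf_ii s hs0 _ _) (isub _ _ _)]
    rw [intervalIntegral.integral_comp_sub_right (fun x => Gf s x), intervalIntegral.integral_comp_sub_right (fun x => Gf s x)]
    have ad := fun a b c => intervalIntegral.integral_add_adjacent_intervals (Gf_ii s hs0 a b) (Gf_ii s hs0 b c)
    have a1 := ad 0 0.18 1.25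
    have a2 := ad 0 1.25 X
    have a3 := ad 0 1.07 (1.25 - 1/6)
    have a4 := ad 0 (1.25 - 1/6) (X - 1/6)
    have a5 := ad 0 (X - 1/6) X
    have b1 := Gf_int_le s hs0 0 0.18 (by norm_num)
    have b2 := le_Gf_int s hs0 1.07 (1.25 - 1/6) (by norm_num)
    have b3 := le_Gf_int s hs0 (X - 1/6) X (by norm_num)
    have hGX : Gf s (X - 1/6) = exp (-(1/1000)) := by
      rw [hX, Gf, if_pos (by linarith)]
      congr 1
      field_simp
      norm_num
      ring
    rw [hGX] at b3
    have nb := num_bound s hs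
    have z1 : (0.18 - 0.18 : ℝ) = 0 := by norm_num
    have z2 : (1.25 - 0.18 : ℝ) = 1.07 := by norm_num
    rw [z1, z2]
    have b2' : (1/75) * Gf s 1.07 ≤ ∫ x in (1.07:ℝ)..(1.25 - 1/6), Gf s x := by
      refine le_trans (le_of_eq ?_) b2
      norm_num
    have b3' : (1/6) * exp (-(1/1000)) ≤ ∫ x in (X - 1/6)..X, Gf s x := by
      refine le_trans (le_of_eq ?_) b3
      ring
    rw [sub_zero] at b1
    linarith
  · intro x hx
    have hGx : exp (-(s / (2 * x))) = Gf s x := by rw [Gf, if_pos hx]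
    have hpow : exp (-(s / (2 * x))) = exp (-(1 / (2 * x))) ^ s := by
      rw [← exp_mul]; congr 1; ring
    have hcs : 0 ≤ |cos (1 / √x)| ^ s := by positivity
    have hxd : 0 < x ^ δ := by positivity
    have hxcd : 0 < xc ^ δ := by positivity
    have G0 : ∀ y, 0 ≤ Gf s y := fun y => by unfold Gf; split_ifs <;> positivity
    -- generic finish
    have fin1 : ∀ m h : ℝ, m ≤ h → 0 ≤ h → xc ≤ x → xc ^ δ * m ≤ h * x ^ δ := by
      intro m h hmh hh hle
      have : xc ^ δ ≤ x ^ δ := rpow_le_rpow hxc.le hle h0.le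
      nlinarith
    rcases le_or_gt x (4 / π ^ 2) with hx4 | hx4
    · have hC : (Set.Ioc 0 (4 / π ^ 2)).indicator C x = -|cos (1 / √x)| ^ s := by
        rw [Set.indicator_of_mem (show x ∈ Set.Ioc 0 (4 / π ^ 2) from ⟨hx, hx4⟩)]
      have h2 : (Set.Ioc 1.25 X).indicator D2 x = 0 := by
        rw [Set.indicator_of_notMem]
        intro h; have := h.1; linarith
      rcases le_or_gt x 0.18 with h18 | h18
      · have h1 : (Set.Ioc 0.18 1.25).indicator D1 x = 0 := by
          rw [Set.indicator_of_notMem]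
          intro h; have := h.1; linarith
        simp only [m0, hC, h1, h2, add_zero]
        rcases le_total x xc with hle | hle
        · have : x ^ δ ≤ xc ^ δ := rpow_le_rpow hx.le hle h0.le
          have h5 : 0 < exp (-(s / (2 * x))) := exp_pos _
          nlinarith
        · apply fin1 _ _ _ _ hle
          · have h5 : 0 < exp (-(s / (2 * x))) := exp_pos _
            linarith
          · rw [hpow]
            exact sub_nonneg.2 (rpow_le_rpow (abs_nonneg _) (hc4 x hle hx4) hs0.le)
      · have h1 : (Set.Ioc 0.18 1.25).indicator D1 x = Gf s x - Gf s (x - 0.18) := by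
          rw [Set.indicator_of_mem (show x ∈ Set.Ioc (0.18:ℝ) 1.25 from ⟨h18, by linarith⟩)]
        simp only [m0, hC, h1, h2, add_zero]
        rw [hGx]
        have g := G0 (x - 0.18)
        rcases le_total x xc with hle | hle
        · have h6 : x ^ δ ≤ xc ^ δ := rpow_le_rpow hx.le hle h0.le
          have h7 : Gf s x - |cos (1 / √x)| ^ s ≤ 0 := by
            rw [← hGx, hpow]
            exact sub_nonpos.2 (rpow_le_rpow (exp_pos _).le (hc3 x (by linarith) hle) hs0.le)
          nlinarith
        · apply fin1 _ _ _ _ hle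
          · linarith
          · rw [← hGx, hpow]
            exact sub_nonneg.2 (rpow_le_rpow (abs_nonneg _) (hc4 x hle hx4) hs0.le)
    · have hC : (Set.Ioc 0 (4 / π ^ 2)).indicator C x = 0 := by
        rw [Set.indicator_of_notMem]
        intro h; have := h.2; linarith
      have hxcx : xc ≤ x := by linarith
      rw [hGx]
      have q1 : |cos (1 / √x)| ^ s ≤ Gf s (x - 1/6) :=
        cos_rpow_le_Gf s x (1/6) hs0 hx4.le (by have : 0 ≤ 1 / (60 * x) := by positivity
                                                linarith) (by linarith)
      have q2 : Gf s (x - 1/6) ≤ Gf s x := Gf_mono s hs0 (by linarith)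
      apply fin1 _ _ _ _ hxcx
      · rcases le_or_gt x 1.25 with h125 | h125
        · have h1 : (Set.Ioc 0.18 1.25).indicator D1 x = Gf s x - Gf s (x - 0.18) := by
            rw [Set.indicator_of_mem (show x ∈ Set.Ioc (0.18:ℝ) 1.25 from ⟨by linarith, h125⟩)]
          have h2 : (Set.Ioc 1.25 X).indicator D2 x = 0 := by
            rw [Set.indicator_of_notMem]
            intro h; have := h.1; linarith
          simp only [m0, hC, h1, h2, add_zero, zero_add]
          have := cos_rpow_le_Gf s x 0.18 hs0 hx4.le (by
            have : 1 / 75 ≤ 1 / (60 * x) := one_div_le_one_div_of_le (by positivity) (by linarith)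
            linarith) (by linarith)
          linarith
        · have h1 : (Set.Ioc 0.18 1.25).indicator D1 x = 0 := by
            rw [Set.indicator_of_notMem]
            intro h; have := h.2; linarith
          by_cases hXx : x ≤ X
          · have h2 : (Set.Ioc 1.25 X).indicator D2 x = Gf s x - Gf s (x - 1/6) := by
              rw [Set.indicator_of_mem (show x ∈ Set.Ioc (1.25:ℝ) X from ⟨h125, hXx⟩)]
            simp only [m0, hC, h1, h2, zero_add]
            linarith
          · have h2 : (Set.Ioc 1.25 X).indicator D2 x = 0 := by
              rw [Set.indicator_of_notMem]
              intro h; exact hXx h.2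
            simp only [m0, hC, h1, h2, zero_add]
            linarith
      · linarith

lemma ES_scale (m : ℕ) (a : Fin m → ℝ) (c q : ℝ) :
    ES m (fun i => c * a i) (fun t => |t| ^ q) = |c| ^ q * ES m a (fun t => |t| ^ q) := by
  rw [← ES_mul]
  unfold ES
  congr 1
  refine Finset.sum_congr rfl fun σ _ => ?_
  beta_reduce
  rw [← mul_rpow (abs_nonneg _) (abs_nonneg _), ← abs_mul, Finset.mul_sum]
  congr 2
  exact Finset.sum_congr rfl fun i _ => by ring

lemma khin (q : ℝ) (hq : 2 ≤ q) (m : ℕ) (a : Fin m → ℝ) :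
    ES m a (fun t => |t| ^ q) ≤ gm q * (∑ i, a i ^ 2) ^ (q / 2) := by
  rcases hq.eq_or_lt with rfl | h2
  · rw [gm_two]
    have := ES_sq m a 0
    simp at this
    simp [this]
  rcases le_or_gt q 3 with h3 | h3
  swap
  · exact khin_A q h3 m a
  have hS : 0 ≤ ∑ i, a i ^ 2 := Finset.sum_nonneg fun i _ => sq_nonneg _
  rcases hS.eq_or_lt with hz | hpos
  · have ha : ∀ i, a i = 0 := by
      intro i
      have := (Finset.sum_eq_zero_iff_of_nonneg (fun i _ => sq_nonneg (a i))).1 hz.symm i (Finset.mem_univ _)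
      exact pow_eq_zero_iff (two_ne_zero) |>.1 this
    rw [← hz, zero_rpow (by linarith)]
    have hq0 : q ≠ 0 := by linarith
    simp [ES, ha, hq0]
  set S := ∑ i, a i ^ 2 with hSdef
  have hr : 0 < √S := Real.sqrt_pos.2 hpos
  let b : Fin m → ℝ := fun i => a i / √S
  have hb : ∑ i, b i ^ 2 = 1 := by
    simp only [b, div_pow, Real.sq_sqrt hpos.le]
    rw [← Finset.sum_div, ← hSdef, div_self hpos.ne']
  have hab : a = fun i => √S * b i := by
    funext i
    simp only [b]
    field_simp
  have key : ES m b (fun t => |t| ^ q) ≤ gm q := by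
    by_cases hex : ∃ i, 3/5 ≤ b i ^ 2
    · obtain ⟨i0, hi⟩ := hex
      exact khin_B1 q h2 h3 m b hb i0 hi
    · push Not at hex
      have := khin_B2 ((q - 2) / 2) (by linarith) (by linarith)
        (fun s hs => lemma_H _ (by linarith) s hs) m b hb (fun i => (hex i).le)
      have e : 2 + 2 * ((q - 2) / 2) = q := by ring
      rwa [e] at this
  have hsc : |√S| ^ q = S ^ (q / 2) := by
    rw [abs_of_pos hr, Real.sqrt_eq_rpow, ← rpow_mul hpos.le]
    congr 1; ring
  rw [hab, ES_scale, hsc, mul_comm]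
  gcongr

end

section

lemma assembly (hK : ∀ q : ℝ, 2 ≤ q → ∀ (m : ℕ) (a : Fin m → ℝ),
      ES m a (fun t => |t| ^ q) ≤ gm q * (∑ i, a i ^ 2) ^ (q / 2))
    (m d : ℕ) (hm : 0 < m) (x : Fin m → Fin d → ℝ)
    (p ps : ℝ) (hp : 1 < p) (hp2 : p ≤ 2) (hconj : 1 / p + 1 / ps = 1)
    (W : ℝ) (hW : 0 < W) :
    expRademacher m (fun σ =>
        sSup {t : ℝ | ∃ w : Fin d → ℝ, pNorm p w ≤ W ∧
          t = (1 / (m : ℝ)) * ∑ i, σ i * ∑ j, w j * x i j}) ≤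
      (Real.sqrt 2 * W / m) * (Real.Gamma ((ps + 1) / 2) / Real.sqrt π) ^ (1 / ps) *
        pNorm ps (fun j : Fin d => pNorm 2 (fun i : Fin m => x i j)) := by
  have hm' : (0:ℝ) < m := by exact_mod_cast hm
  have hp0 : 0 < p := by linarith
  have hinv : 1 / ps = 1 - 1 / p := by linarith
  have h1p : 1 / p < 1 := by rw [div_lt_one hp0]; exact hp
  have h1p' : 1 / 2 ≤ 1 / p := one_div_le_one_div_of_le hp0 hp2
  have hps0 : 0 < ps := by
    have : 0 < 1 / ps := by linarith
    exact one_div_pos.1 this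
  have hps2 : 2 ≤ ps := by
    have : 1 / ps ≤ 1 / 2 := by linarith
    exact (one_div_le_one_div hps0 (by norm_num)).1 this
  have hholder : p.HolderConjugate ps := by
    rw [Real.holderConjugate_iff]
    refine ⟨hp, ?_⟩
    rw [← one_div, ← one_div]; exact hconj
  have hG : 0 ≤ Real.Gamma ((ps + 1) / 2) / √π := by
    have := Real.Gamma_pos_of_pos (by linarith : 0 < (ps + 1) / 2)
    positivity
  -- coordinates
  set S : (Fin m → Bool) → Fin d → ℝ := fun s j => ∑ i, signVec m s i * x i j with hS
  have hsup : ∀ s : Fin m → Bool, sSup {t : ℝ | ∃ w : Fin d → ℝ, pNorm p w ≤ W ∧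
          t = (1 / (m : ℝ)) * ∑ i, signVec m s i * ∑ j, w j * x i j} ≤ W / m * pNorm ps (S s) := by
    intro s
    have hn : 0 ≤ pNorm ps (S s) := by
      unfold pNorm
      exact rpow_nonneg (Finset.sum_nonneg fun j _ => rpow_nonneg (abs_nonneg _) _) _
    apply Real.sSup_le
    · rintro t ⟨w, hw, rfl⟩
      have e : ∑ i, signVec m s i * ∑ j, w j * x i j = ∑ j, w j * S s j := by
        simp only [hS, Finset.mul_sum]
        rw [Finset.sum_comm]
        refine Finset.sum_congr rfl fun j _ => Finset.sum_congr rfl fun i _ => by ring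
      rw [e]
      have h := Real.inner_le_Lp_mul_Lq Finset.univ w (S s) hholder
      have h2 : ∑ j, w j * S s j ≤ W * pNorm ps (S s) :=
        h.trans (mul_le_mul_of_nonneg_right hw hn)
      calc 1 / (m:ℝ) * ∑ j, w j * S s j ≤ 1 / (m:ℝ) * (W * pNorm ps (S s)) := by gcongr
        _ = _ := by ring
    · positivity
  -- Jensen
  have hJ : (∑ s, pNorm ps (S s)) / 2 ^ m ≤ ((∑ s, ∑ j, |S s j| ^ ps) / 2 ^ m) ^ (1 / ps) := by
    have hc := (Real.arith_mean_le_rpow_mean (Finset.univ : Finset (Fin m → Bool)) (fun _ => (1:ℝ) / 2 ^ m)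
      (fun s => pNorm ps (S s)) (fun _ _ => by positivity) (by simp) (fun s _ => by
        exact rpow_nonneg (Finset.sum_nonneg fun j _ => rpow_nonneg (abs_nonneg _) _) _) (by linarith : 1 ≤ ps))
    rw [← Finset.mul_sum, ← Finset.mul_sum] at hc
    have e : ∀ s, pNorm ps (S s) ^ ps = ∑ j, |S s j| ^ ps := by
      intro s
      unfold pNorm
      rw [← rpow_mul (Finset.sum_nonneg fun j _ => rpow_nonneg (abs_nonneg _) _), one_div_mul_cancel hps0.ne', rpow_one]
    simp only [e] at hc
    rw [div_eq_inv_mul, div_eq_inv_mul, ← one_div]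
    exact hc
  have hKh : (∑ s, ∑ j, |S s j| ^ ps) / 2 ^ m ≤ gm ps * ∑ j, (pNorm 2 (fun i => x i j)) ^ ps := by
    rw [Finset.sum_comm, Finset.sum_div, Finset.mul_sum]
    refine Finset.sum_le_sum fun j _ => ?_
    have h := hK ps hps2 m (fun i => x i j)
    unfold ES at h
    refine h.trans (le_of_eq ?_)
    unfold pNorm
    rw [← rpow_mul (Finset.sum_nonneg fun j _ => rpow_nonneg (abs_nonneg _) _)]
    simp only [rpow_two, sq_abs]
    congr 2; ring
  unfold expRademacher
  calc (∑ s : Fin m → Bool, sSup {t : ℝ | ∃ w : Fin d → ℝ, pNorm p w ≤ W ∧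
          t = (1 / (m : ℝ)) * ∑ i, signVec m s i * ∑ j, w j * x i j}) / 2 ^ m
      ≤ (∑ s : Fin m → Bool, W / m * pNorm ps (S s)) / 2 ^ m := by
        gcongr with s
        exact hsup s
    _ = W / m * ((∑ s, pNorm ps (S s)) / 2 ^ m) := by rw [← Finset.mul_sum, mul_div_assoc]
    _ ≤ W / m * (gm ps * ∑ j, (pNorm 2 (fun i => x i j)) ^ ps) ^ (1 / ps) := by
        gcongr
        refine hJ.trans ?_
        apply rpow_le_rpow _ hKh (by positivity)
        exact div_nonneg (Finset.sum_nonneg fun s _ => Finset.sum_nonneg fun j _ => rpow_nonneg (abs_nonneg _) _) (by positivity)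
    _ = _ := by
        have hn : ∀ j, 0 ≤ pNorm 2 (fun i => x i j) := fun j =>
          rpow_nonneg (Finset.sum_nonneg fun j _ => rpow_nonneg (abs_nonneg _) _) _
        have e1 : ∑ j, (pNorm 2 (fun i => x i j)) ^ ps = ∑ j, |pNorm 2 (fun i => x i j)| ^ ps :=
          Finset.sum_congr rfl fun j _ => by rw [abs_of_nonneg (hn j)]
        unfold gm
        rw [e1, mul_rpow (by rw [mul_div_assoc]; positivity)
          (Finset.sum_nonneg fun j _ => rpow_nonneg (abs_nonneg _) _), mul_div_assoc,
          mul_rpow (by positivity) hG, ← rpow_mul (by norm_num), show ps / 2 * (1 / ps) = 1 / 2 by field_simp,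
          ← sqrt_eq_rpow]
        conv_rhs => rw [pNorm]
        ring

end

/-- Rademacher complexity upper bound for 1 < p ≤ 2:
E_σ[sup_{‖w‖_p ≤ W} (1/m) Σᵢ σᵢ (w·xᵢ)]
  ≤ (√2 W/m) (Γ((p*+1)/2)/√π)^{1/p*} ‖Xᵀ‖_{2,p*}. -/
theorem rademacher_linear_upper_p_le_two (m d : ℕ) (hm : 0 < m) (x : Fin m → Fin d → ℝ)
    (p ps : ℝ) (hp : 1 < p) (hp2 : p ≤ 2) (hconj : 1 / p + 1 / ps = 1)
    (W : ℝ) (hW : 0 < W) :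
    expRademacher m (fun σ =>
        sSup {t : ℝ | ∃ w : Fin d → ℝ, pNorm p w ≤ W ∧
          t = (1 / (m : ℝ)) * ∑ i, σ i * ∑ j, w j * x i j}) ≤
      (Real.sqrt 2 * W / m) * (Real.Gamma ((ps + 1) / 2) / Real.sqrt π) ^ (1 / ps) *
        pNorm ps (fun j : Fin d => pNorm 2 (fun i : Fin m => x i j)) := by
  exact assembly khin m d hm x p ps hp hp2 hconj W hW
end

section
/- Let x₁,…,x_m ∈ ℝ^d, σᵢ i.i.d. Rademacher variables, 1 ≤ p ≤ ∞ with conjugate p*, and W > 0. Then E_σ[ sup_{‖w‖_p ≤ W} (1/m) Σᵢ σᵢ (w·xᵢ) ] ≥ (W/(√2·m)) · ‖Xᵀ‖_{2,p*}. -/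
open Real Finset

namespace Khin

noncomputable def E (n : ℕ) (f : (Fin n → Bool) → ℝ) : ℝ := (∑ s, f s) / 2 ^ n

def flip {n : ℕ} (i : Fin n) (s : Fin n → Bool) : Fin n → Bool := Function.update s i (!s i)

noncomputable def D (n : ℕ) (f : (Fin n → Bool) → ℝ) : ℝ :=
  ∑ i, E n (fun s => (f s - f (flip i s)) ^ 2) / 4

lemma E_add (n : ℕ) (f g : (Fin n → Bool) → ℝ) :
    E n (fun s => f s + g s) = E n f + E n g := by
  simp only [E, Finset.sum_add_distrib, add_div]

lemma E_mul (n : ℕ) (c : ℝ) (f : (Fin n → Bool) → ℝ) :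
    E n (fun s => c * f s) = c * E n f := by
  simp only [E, ← Finset.mul_sum, mul_div_assoc]

lemma E_mono (n : ℕ) (f g : (Fin n → Bool) → ℝ) (h : ∀ s, f s ≤ g s) : E n f ≤ E n g := by
  unfold E
  gcongr with s
  exact h s

lemma E_sum (n : ℕ) {ι : Type} (t : Finset ι) (f : ι → (Fin n → Bool) → ℝ) :
    E n (fun s => ∑ i ∈ t, f i s) = ∑ i ∈ t, E n (f i) := by
  simp only [E]
  rw [Finset.sum_comm, Finset.sum_div]

lemma E_equiv (n : ℕ) (e : (Fin n → Bool) ≃ (Fin n → Bool)) (f : (Fin n → Bool) → ℝ) :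
    E n (fun s => f (e s)) = E n f := by
  simp only [E, Equiv.sum_comp e f]

lemma E_succ (n : ℕ) (f : (Fin (n+1) → Bool) → ℝ) :
    E (n+1) f = (E n (fun s => f (Fin.cons true s)) + E n (fun s => f (Fin.cons false s))) / 2 := by
  have h : ∑ s, f s = ∑ q : Bool × (Fin n → Bool), f (Fin.cons q.1 q.2) :=
    (Equiv.sum_comp (Fin.consEquiv (fun _ : Fin (n+1) => Bool)) f).symm
  simp only [E, h, Fintype.sum_prod_type, Fintype.sum_bool, pow_succ]
  field_simp

lemma flip_zero (n : ℕ) (b : Bool) (s : Fin n → Bool) :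
    flip (0 : Fin (n+1)) (Fin.cons b s) = Fin.cons (!b) s := by
  simp [flip, Fin.update_cons_zero]

lemma flip_succ (n : ℕ) (b : Bool) (i : Fin n) (s : Fin n → Bool) :
    flip i.succ (Fin.cons b s) = (Fin.cons b (flip i s) : Fin (n+1) → Bool) := by
  simp [flip, Fin.cons_update]

lemma D_nonneg (n : ℕ) (f : (Fin n → Bool) → ℝ) : 0 ≤ D n f := by
  unfold D E; positivity

noncomputable def gp {n : ℕ} (f : (Fin (n+1) → Bool) → ℝ) (s : Fin n → Bool) : ℝ :=
  (f (Fin.cons true s) + f (Fin.cons false s)) / 2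
noncomputable def hp {n : ℕ} (f : (Fin (n+1) → Bool) → ℝ) (s : Fin n → Bool) : ℝ :=
  (f (Fin.cons true s) - f (Fin.cons false s)) / 2

lemma f_true {n : ℕ} (f : (Fin (n+1) → Bool) → ℝ) (s : Fin n → Bool) :
    f (Fin.cons true s) = gp f s + hp f s := by unfold gp hp; ring
lemma f_false {n : ℕ} (f : (Fin (n+1) → Bool) → ℝ) (s : Fin n → Bool) :
    f (Fin.cons false s) = gp f s + (-1) * hp f s := by unfold gp hp; ring

lemma D_succ (n : ℕ) (f : (Fin (n+1) → Bool) → ℝ) :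
    D (n+1) f = D n (gp f) + D n (hp f) + E n (fun s => hp f s ^ 2) := by
  unfold D
  rw [Fin.sum_univ_succ, ← Finset.sum_add_distrib, add_comm]
  congr 1
  · refine Finset.sum_congr rfl fun i _ => ?_
    rw [E_succ]
    simp only [flip_succ, f_true, f_false]
    rw [← add_div, ← E_add, ← E_add]
    simp only [E]
    rw [div_div, div_div, div_div, Finset.sum_div, Finset.sum_div]
    refine Finset.sum_congr rfl fun s _ => ?_
    field_simp
    ring
  · rw [E_succ, ← E_add]
    simp only [flip_zero, Bool.not_true, Bool.not_false, f_true, f_false]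
    simp only [E]
    rw [div_div, div_div, Finset.sum_div, Finset.sum_div]
    refine Finset.sum_congr rfl fun s _ => ?_
    field_simp
    ring

lemma E_succ_gp (n : ℕ) (f : (Fin (n+1) → Bool) → ℝ) : E (n+1) f = E n (gp f) := by
  rw [E_succ, ← E_add]
  simp only [E, gp]
  rw [div_div, Finset.sum_div, Finset.sum_div]
  refine Finset.sum_congr rfl fun s _ => ?_
  field_simp

lemma E_succ_sq (n : ℕ) (f : (Fin (n+1) → Bool) → ℝ) :
    E (n+1) (fun s => f s ^ 2) = E n (fun s => gp f s ^ 2) + E n (fun s => hp f s ^ 2) := by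
  rw [E_succ_gp, ← E_add]
  congr 1
  funext s
  simp only [gp, hp]; ring

lemma poincare (n : ℕ) (f : (Fin n → Bool) → ℝ) :
    E n (fun s => f s ^ 2) - (E n f) ^ 2 ≤ D n f := by
  induction n with
  | zero => simp [E, D]
  | succ n ih =>
    rw [E_succ_sq, E_succ_gp, D_succ]
    have := ih (gp f)
    have := D_nonneg n (hp f)
    linarith

lemma poincare2 (n : ℕ) (f : (Fin n → Bool) → ℝ) :
    2 * (E n (fun s => f s ^ 2) - (E n f) ^ 2) ≤
      D n f + ∑ i, (E n (fun s => signVec n s i * f s)) ^ 2 := by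
  induction n with
  | zero => simp [E, D]
  | succ n ih =>
    rw [E_succ_sq, E_succ_gp, D_succ, Fin.sum_univ_succ]
    have h1 := ih (gp f)
    have h2 := poincare n (hp f)
    have e0 : E (n+1) (fun s => signVec (n+1) s 0 * f s) = E n (hp f) := by
      rw [E_succ_gp]
      congr 1
      funext s
      simp [gp, hp, signVec]; ring
    have e1 : ∀ i : Fin n, E (n+1) (fun s => signVec (n+1) s i.succ * f s)
        = E n (fun s => signVec n s i * gp f s) := by
      intro i
      rw [E_succ_gp]
      congr 1
      funext s
      simp only [gp, signVec, Fin.cons_succ]; ring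
    simp only [e0, e1]
    linarith

lemma flip_flip {n : ℕ} (i : Fin n) (s : Fin n → Bool) : flip i (flip i s) = s := by
  simp [flip]

def flipEquiv {n : ℕ} (i : Fin n) : (Fin n → Bool) ≃ (Fin n → Bool) :=
  ⟨flip i, flip i, flip_flip i, flip_flip i⟩

def negEquiv (n : ℕ) : (Fin n → Bool) ≃ (Fin n → Bool) :=
  ⟨fun s i => !s i, fun s i => !s i, fun s => by simp, fun s => by simp⟩

noncomputable def L {n : ℕ} (a : Fin n → ℝ) (s : Fin n → Bool) : ℝ := ∑ i, signVec n s i * a i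

lemma L_flip {n : ℕ} (a : Fin n → ℝ) (s : Fin n → Bool) (i : Fin n) :
    L a (flip i s) = L a s - 2 * (signVec n s i * a i) := by
  have : L a s - L a (flip i s) = 2 * (signVec n s i * a i) := by
    unfold L
    rw [← Finset.sum_sub_distrib, Finset.sum_eq_single i]
    · cases h : s i <;> simp [signVec, flip, h] <;> ring
    · intro j _ hj
      simp [signVec, flip, Function.update_of_ne hj]
    · simp
  linarith

lemma L_neg {n : ℕ} (a : Fin n → ℝ) (s : Fin n → Bool) : L a (negEquiv n s) = - L a s := by
  unfold L
  rw [← Finset.sum_neg_distrib]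
  refine Finset.sum_congr rfl fun i _ => ?_
  cases h : s i <;> simp [signVec, negEquiv, h]

lemma E_sq (n : ℕ) (a : Fin n → ℝ) : E n (fun s => L a s ^ 2) = ∑ i, a i ^ 2 := by
  induction n with
  | zero => simp [E, L]
  | succ n ih =>
    have hg : gp (L a) = L (fun i => a i.succ) := by
      funext s
      simp [gp, L, Fin.sum_univ_succ, signVec]
      ring
    have hh : hp (L a) = fun _ => a 0 := by
      funext s
      simp [hp, L, Fin.sum_univ_succ, signVec]
    rw [E_succ_sq, hg, hh, ih, Fin.sum_univ_succ, add_comm]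
    simp [E]

lemma D_le (n : ℕ) (a : Fin n → ℝ) :
    D n (fun s => |L a s|) ≤ E n (fun s => |L a s| ^ 2) := by
  have h1 : ∀ i : Fin n, E n (fun s => (|L a s| - |L a (flip i s)|) ^ 2)
      = 2 * E n (fun s => |L a s| * (|L a s| - |L a (flip i s)|)) := by
    intro i
    have h := E_equiv n (flipEquiv i) (fun s => |L a s| * (|L a s| - |L a (flip i s)|))
    simp only [flipEquiv, Equiv.coe_fn_mk, flip_flip] at h
    rw [two_mul]
    nth_rewrite 1 [← h]
    rw [← E_add]
    congr 1
    funext s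
    ring
  unfold D
  simp only [h1]
  have h2 : ∀ z : ℝ, 2 * z / 4 = (1/2) * z := fun z => by ring
  simp only [h2]
  rw [← Finset.mul_sum, ← E_sum, ← E_mul]
  apply E_mono
  intro s
  rw [← Finset.mul_sum, Finset.sum_sub_distrib]
  have h3 : ((n:ℝ) - 2) * |L a s| ≤ ∑ i, |L a (flip i s)| := by
    have h4 : ∑ i, L a (flip i s) = ((n:ℝ) - 2) * L a s := by
      simp only [L_flip]
      rw [Finset.sum_sub_distrib, ← Finset.mul_sum]
      change _ - 2 * L a s = _
      simp; ring
    calc ((n:ℝ) - 2) * |L a s| ≤ |(n:ℝ) - 2| * |L a s| := by gcongr; exact le_abs_self _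
      _ = |∑ i, L a (flip i s)| := by rw [h4, abs_mul]
      _ ≤ _ := Finset.abs_sum_le_sum_abs _ _
  have h5 : (∑ _i : Fin n, |L a s|) = n * |L a s| := by simp
  rw [h5]
  nlinarith [abs_nonneg (L a s)]

lemma khintchine (n : ℕ) (a : Fin n → ℝ) :
    √(∑ i, a i ^ 2) ≤ √2 * E n (fun s => |L a s|) := by
  have h1 := poincare2 n (fun s => |L a s|)
  have h2 := D_le n a
  have h3 : ∀ i, E n (fun s => signVec n s i * |L a s|) = 0 := by
    intro i
    have h := E_equiv n (negEquiv n) (fun s => signVec n s i * |L a s|)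
    have h' : (fun s => signVec n (negEquiv n s) i * |L a (negEquiv n s)|)
        = fun s => (-1) * (signVec n s i * |L a s|) := by
      funext s
      rw [L_neg, abs_neg]
      cases h : s i <;> simp [signVec, negEquiv, h]
    rw [h', E_mul] at h
    linarith
  simp only [h3] at h1
  simp only [sq_abs, E_sq] at h1 h2
  have h4 : 0 ≤ E n (fun s => |L a s|) := by unfold E; positivity
  rw [Real.sqrt_le_left (by positivity), mul_pow, Real.sq_sqrt (by norm_num)]
  norm_num at h1
  linarith

end Khin

open Khin in
theorem rademacher_linear_lower (m d : ℕ) (hm : 0 < m) (x : Fin m → Fin d → ℝ)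
    (p ps : ℝ) (hp : 1 ≤ p) (hps : 1 ≤ ps) (hconj : 1 / p + 1 / ps = 1)
    (W : ℝ) (hW : 0 < W) :
    (W / (Real.sqrt 2 * m)) *
        pNorm ps (fun j : Fin d => pNorm 2 (fun i : Fin m => x i j)) ≤
      expRademacher m (fun σ =>
        sSup {t : ℝ | ∃ w : Fin d → ℝ, pNorm p w ≤ W ∧
          t = (1 / (m : ℝ)) * ∑ i, σ i * ∑ j, w j * x i j}) := by
  have hm' : (0:ℝ) < m := by exact_mod_cast hm
  have hpq : p.HolderConjugate ps := by
    have h0 : 0 < 1 / ps := by positivity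
    have : 1 < p := by
      rcases hp.lt_or_eq with h | h
      · exact h
      · rw [← h] at hconj; norm_num at hconj; rw [one_div, hconj] at h0; norm_num at h0
    rw [Real.holderConjugate_iff]
    exact ⟨this, by simpa using hconj⟩
  set c : Fin d → ℝ := fun j => pNorm 2 (fun i : Fin m => x i j) with hc
  have hc2 : ∀ j, c j = √(∑ i, x i j ^ 2) := by
    intro j
    simp [hc, pNorm, Real.sqrt_eq_rpow]
  have hc0 : ∀ j, 0 ≤ c j := fun j => by rw [hc2]; positivity
  -- dual vector
  obtain ⟨y, hy0, hy1, hy2⟩ : ∃ y : Fin d → ℝ, (∀ j, 0 ≤ y j) ∧ pNorm p y ≤ 1 ∧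
      pNorm ps c = ∑ j, y j * c j := by
    obtain ⟨⟨g, hg, hg2⟩, -⟩ := NNReal.isGreatest_Lp Finset.univ
      (fun j => (⟨c j, hc0 j⟩ : NNReal)) hpq.symm
    refine ⟨fun j => g j, fun j => (g j).2, ?_, ?_⟩
    · unfold pNorm
      simp only [NNReal.abs_eq]
      have : (∑ j, (g j : ℝ) ^ p) ≤ 1 := by exact_mod_cast hg
      exact Real.rpow_le_one (by positivity) this (by positivity)
    · have := congrArg NNReal.toReal hg2
      push_cast at this
      unfold pNorm
      have habs : ∀ j, |c j| = c j := fun j => abs_of_nonneg (hc0 j)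
      simp only [habs]
      refine this.symm.trans ?_
      exact Finset.sum_congr rfl fun j _ => mul_comm _ _
  set u : Fin d → (Fin m → Bool) → ℝ := fun j s => L (fun i => x i j) s with hu
  have hsw : ∀ (w : Fin d → ℝ) (s : Fin m → Bool),
      ∑ i, signVec m s i * ∑ j, w j * x i j = ∑ j, w j * u j s := by
    intro w s
    simp only [hu, L, Finset.mul_sum]
    rw [Finset.sum_comm]
    refine Finset.sum_congr rfl fun j _ => Finset.sum_congr rfl fun i _ => by ring
  have key : ∀ s : Fin m → Bool, (W / m) * ∑ j, y j * |u j s| ≤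
      sSup {t : ℝ | ∃ w : Fin d → ℝ, pNorm p w ≤ W ∧
          t = (1 / (m : ℝ)) * ∑ i, signVec m s i * ∑ j, w j * x i j} := by
    intro s
    apply le_csSup
    · refine ⟨(1 / (m : ℝ)) * (W * pNorm ps (fun j => u j s)), ?_⟩
      rintro t ⟨w, hw, rfl⟩
      rw [hsw]
      have h := Real.inner_le_Lp_mul_Lq Finset.univ w (fun j => u j s) hpq
      have h' : 0 ≤ pNorm ps (fun j => u j s) := by unfold pNorm; positivity
      gcongr
      exact h.trans (mul_le_mul_of_nonneg_right hw h')
    · refine ⟨fun j => W * (if 0 ≤ u j s then y j else - y j), ?_, ?_⟩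
      · have : ∀ j, |W * (if 0 ≤ u j s then y j else - y j)| = W * |y j| := by
          intro j
          rw [abs_mul, abs_of_pos hW]
          split_ifs <;> simp
        have hp0 : 0 < p := by linarith
        unfold pNorm at hy1 ⊢
        simp only [this]
        simp only [Real.mul_rpow hW.le (abs_nonneg _)]
        rw [← Finset.mul_sum, Real.mul_rpow (by positivity) (by positivity), ← Real.rpow_mul hW.le,
          mul_one_div_cancel hp0.ne', Real.rpow_one]
        exact mul_le_of_le_one_right hW.le hy1
      · rw [hsw, div_eq_mul_one_div, mul_comm W, mul_assoc, Finset.mul_sum]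
        congr 1
        refine Finset.sum_congr rfl fun j _ => ?_
        split_ifs with h
        · rw [abs_of_nonneg h]; ring
        · rw [abs_of_neg (not_le.mp h)]; ring
  have step := E_mono m _ _ key
  refine le_trans ?_ step
  rw [E_mul, E_sum]
  simp only [E_mul]
  have hk : ∑ j, y j * c j ≤ √2 * ∑ j, y j * E m (fun s => |u j s|) := by
    rw [Finset.mul_sum]
    refine Finset.sum_le_sum fun j _ => ?_
    have := khintchine m (fun i => x i j)
    rw [hc2, mul_left_comm]
    exact mul_le_mul_of_nonneg_left this (hy0 j)
  rw [hy2]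
  calc W / (√2 * m) * ∑ j, y j * c j
      ≤ W / (√2 * m) * (√2 * ∑ j, y j * E m (fun s => |u j s|)) := by gcongr
    _ = _ := by
      have : √2 ≠ 0 := by positivity
      field_simp
end
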